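/- Let B denote the set of functions f : G_n → ℂ that are restrictions to G_n of polynomial functions on M_{2n}(ℂ) and satisfy f(u⁻¹xv) = f(x) for all u ∈ U_n⁻, v ∈ U_{n−1}, and x ∈ G_n. Then B is a ℂ-subalgebra of the algebra of functions on G_n, and the restrictions to G_n of the standard monomials δ_Δ, as Δ ranges over all multichains in 𝓛, form a ℂ-vector space basis of B. -/

import Mathlib

noncomputable section

namespace SpBranch


/-! Elements of `Fin (2*n)` carry the 1-based label `(x : ℕ) + 1`. -/

/-- The column set `I_i = {1, …, i}` (1-based labels). -/
def Iset (n i : ℕ) : Finset (Fin (2*n)) :=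
  Finset.univ.filter (fun x => (x : ℕ) + 1 ≤ i)

/-- The column set `J_j = {1, …, j} ∪ {n}` (1-based labels). -/
def Jset (n j : ℕ) : Finset (Fin (2*n)) :=
  Finset.univ.filter (fun x => (x : ℕ) + 1 ≤ j ∨ (x : ℕ) + 1 = n)

/-- The column set `J′_j = {1, …, j} ∪ {n+1}` (1-based labels). -/
def JPset (n j : ℕ) : Finset (Fin (2*n)) :=
  Finset.univ.filter (fun x => (x : ℕ) + 1 ≤ j ∨ (x : ℕ) + 1 = n + 1)

/-- The column set `K_k = {1, …, k} ∪ {n, n+1}` (1-based labels). -/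
def Kset (n k : ℕ) : Finset (Fin (2*n)) :=
  Finset.univ.filter (fun x => (x : ℕ) + 1 ≤ k ∨ (x : ℕ) + 1 = n ∨ (x : ℕ) + 1 = n + 1)

/-- The underlying set of the poset `𝓛`. -/
def LSet (n : ℕ) : Set (Finset (Fin (2*n))) :=
  {C | (∃ i, 1 ≤ i ∧ i ≤ n - 1 ∧ C = Iset n i) ∨
       (∃ j, j ≤ n - 1 ∧ C = Jset n j) ∨
       (∃ j, j ≤ n - 1 ∧ C = JPset n j) ∨
       (∃ k, k ≤ n - 2 ∧ C = Kset n k)}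

/-- The generating relations of the partial order `⪯` on `𝓛`:
`J_i ⪯ J′_i ⪯ I_i ⪯ J_{i−1}`, `J′_i ⪯ K_{i−1} ⪯ J_{i−1}`, `J_{i−1} ⪯ J′_{i−1}` for `1 ≤ i ≤ n−1`. -/
def LGen (n : ℕ) (C C' : Finset (Fin (2*n))) : Prop :=
  ∃ i, 1 ≤ i ∧ i ≤ n - 1 ∧
    ((C = Jset n i ∧ C' = JPset n i) ∨
     (C = JPset n i ∧ C' = Iset n i) ∨
     (C = JPset n i ∧ C' = Kset n (i-1)) ∨
     (C = Iset n i ∧ C' = Jset n (i-1)) ∨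
     (C = Kset n (i-1) ∧ C' = Jset n (i-1)) ∨
     (C = Jset n (i-1) ∧ C' = JPset n (i-1)))

/-- The partial order `⪯` on `𝓛`, generated by `LGen`. -/
def LLE (n : ℕ) : Finset (Fin (2*n)) → Finset (Fin (2*n)) → Prop :=
  Relation.ReflTransGen (LGen n)

/-- A multichain in `𝓛`: a finite weakly increasing sequence of elements of `𝓛`. -/
def IsMultichain (n : ℕ) (l : List (Finset (Fin (2*n)))) : Prop :=
  (∀ C ∈ l, C ∈ LSet n) ∧ l.Chain' (LLE n)

/-- `δ_C`: the minor of `X` on rows `1, …, |C|` and columns `C`. -/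
def deltaFn (n : ℕ) (C : Finset (Fin (2*n))) (X : Matrix (Fin (2*n)) (Fin (2*n)) ℂ) : ℂ :=
  Matrix.det (Matrix.of fun i j : Fin C.card =>
    X (Fin.castLE (le_trans C.card_le_univ (by simp)) i) ((C.orderIsoOfFin rfl j).1))

/-- The standard monomial `δ_Δ = δ_{C_1} ⋯ δ_{C_r}` attached to a list `Δ = (C_1, …, C_r)`. -/
def stdMonomial (n : ℕ) (l : List (Finset (Fin (2*n)))) (X : Matrix (Fin (2*n)) (Fin (2*n)) ℂ) : ℂ :=
  (l.map (fun C => deltaFn n C X)).prod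

/-- `f_i = #{j : |C_j| ≥ i}` for a list of column sets. -/
def shapeF (n : ℕ) (l : List (Finset (Fin (2*n)))) (i : ℕ) : ℕ :=
  (l.map (fun C => if i ≤ C.card then 1 else 0)).sum

/-- `d_k` = total number of occurrences of the (1-based) label `k` among the entries of the `C_j`. -/
def shapeD (n : ℕ) (l : List (Finset (Fin (2*n)))) (k : ℕ) : ℕ :=
  (l.map (fun C => if ∃ x : Fin (2*n), x ∈ C ∧ (x : ℕ) + 1 = k then 1 else 0)).sum

/-- `Δ` has shape `F/D` (with `F = (f_1, …, f_n)`, `D = (d_1, …, d_{n-1})`, read as functions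
on 1-based indices). -/
def HasShape (n : ℕ) (l : List (Finset (Fin (2*n)))) (d f : ℕ → ℕ) : Prop :=
  (∀ i, 1 ≤ i → shapeF n l i = f i) ∧ (∀ k, 1 ≤ k → k ≤ n - 1 → shapeD n l k = d k)

/-- A Young diagram with at most `m` rows, recorded as a function on 1-based indices. -/
def IsYoung (m : ℕ) (a : ℕ → ℕ) : Prop :=
  (∀ j k, 1 ≤ j → j ≤ k → a k ≤ a j) ∧ (∀ k, m < k → a k = 0)

/-- `A ⊑ B` : `b_i ≥ a_i ≥ b_{i+1}` for all `i ≥ 1`. -/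
def Interlaces (a b : ℕ → ℕ) : Prop :=
  ∀ i, 1 ≤ i → a i ≤ b i ∧ b (i+1) ≤ a i

/-- The skew-symmetric Gram matrix `[[0, Q_n], [−Q_n, 0]]`. -/
def Jmat (n : ℕ) : Matrix (Fin (2*n)) (Fin (2*n)) ℂ :=
  Matrix.of fun i j =>
    if (i : ℕ) + (j : ℕ) + 1 = 2*n then (if (i : ℕ) < n then 1 else -1) else 0

/-- `G_n = Sp_{2n}(ℂ)`, as a set of matrices. -/
def SpSet (n : ℕ) : Set (Matrix (Fin (2*n)) (Fin (2*n)) ℂ) :=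
  {g | IsUnit g ∧ g.transpose * Jmat n * g = Jmat n}

/-- `U_n⁻`: lower triangular matrices in `G_n` with 1's on the diagonal. -/
def UnMinusSet (n : ℕ) : Set (Matrix (Fin (2*n)) (Fin (2*n)) ℂ) :=
  {g | g ∈ SpSet n ∧ (∀ i j : Fin (2*n), i < j → g i j = 0) ∧ (∀ i, g i i = 1)}

/-- `U_{n−1}`: the image in `G_n` of the upper triangular unipotent subgroup of `G_{n−1}`,
under the embedding `[[A,B],[C,D]] ↦ [[A,0,B],[0,I_2,0],[C,0,D]]`; equivalently, upper
triangular unipotent elements of `G_n` whose rows and columns with (1-based) indices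
`n` and `n+1` agree with the identity matrix. -/
def Un1Set (n : ℕ) : Set (Matrix (Fin (2*n)) (Fin (2*n)) ℂ) :=
  {g | g ∈ SpSet n ∧ (∀ i j : Fin (2*n), j < i → g i j = 0) ∧ (∀ i, g i i = 1) ∧
    (∀ i j : Fin (2*n), ((i : ℕ) + 1 = n ∨ (i : ℕ) = n ∨ (j : ℕ) + 1 = n ∨ (j : ℕ) = n) →
      g i j = if i = j then 1 else 0)}

/-- `fb` is the restriction to `G_n` of a polynomial function on `M_{2n}(ℂ)`. -/
def IsPolyFn (n : ℕ) (fb : ↥(SpSet n) → ℂ) : Prop :=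
  ∃ P : MvPolynomial (Fin (2*n) × Fin (2*n)) ℂ,
    ∀ x : ↥(SpSet n),
      fb x = MvPolynomial.eval (fun rc => (x : Matrix (Fin (2*n)) (Fin (2*n)) ℂ) rc.1 rc.2) P

/-- `fb(u⁻¹ x v) = fb(x)` for `u ∈ U_n⁻`, `v ∈ U_{n−1}`. -/
def IsUInvariant (n : ℕ) (fb : ↥(SpSet n) → ℂ) : Prop :=
  ∀ u ∈ UnMinusSet n, ∀ v ∈ Un1Set n, ∀ x y : ↥(SpSet n),
    (y : Matrix (Fin (2*n)) (Fin (2*n)) ℂ) =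
      u⁻¹ * (x : Matrix (Fin (2*n)) (Fin (2*n)) ℂ) * v → fb y = fb x

/-- The branching algebra `B`, as a set of functions on `G_n`. -/
def BSet (n : ℕ) : Set (↥(SpSet n) → ℂ) :=
  {fb | IsPolyFn n fb ∧ IsUInvariant n fb}

/-- `t = diag(t_1, …, t_n, t_n⁻¹, …, t_1⁻¹)` (1-based data `t : ℕ → ℂ`). -/
def torusT (n : ℕ) (t : ℕ → ℂ) : Matrix (Fin (2*n)) (Fin (2*n)) ℂ :=
  Matrix.diagonal (fun p => if (p : ℕ) + 1 ≤ n then t ((p : ℕ) + 1) else (t (2*n - (p : ℕ)))⁻¹)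

/-- `s = diag(s_1, …, s_{n−1}, 1, 1, s_{n−1}⁻¹, …, s_1⁻¹)` (1-based data `s : ℕ → ℂ`). -/
def torusS (n : ℕ) (s : ℕ → ℂ) : Matrix (Fin (2*n)) (Fin (2*n)) ℂ :=
  Matrix.diagonal (fun p => if (p : ℕ) + 1 ≤ n - 1 then s ((p : ℕ) + 1)
    else if (p : ℕ) + 1 = n ∨ (p : ℕ) = n then 1 else (s (2*n - (p : ℕ)))⁻¹)



/-- The weight `wt(C) = Σ_r c_r N^{n−r}` of a column set (1-based entries `c_1 < c_2 < …`). -/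
def wtC (n N : ℕ) (C : Finset (Fin (2*n))) : ℕ :=
  ∑ r : Fin C.card, (((C.orderIsoOfFin rfl r).1 : ℕ) + 1) * N ^ (n - ((r : ℕ) + 1))

/-- A pair of Young diagrams `(D, F)` is of order type `σ` (where `σ i = true` means `≥`,
`σ i = false` means `≤`): for `1 ≤ i ≤ n−1`, `σ_i = ≥` implies `d_i ≥ f_{i+1}` and
`σ_i = ≤` implies `d_i ≤ f_{i+1}`. -/
def OfOrderType (n : ℕ) (σ : ℕ → Bool) (d f : ℕ → ℕ) : Prop :=
  ∀ i, 1 ≤ i → i ≤ n - 1 →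
    (σ i = true → f (i+1) ≤ d i) ∧ (σ i = false → d i ≤ f (i+1))

/-- The underlying set of the poset `Γ`: pairs `(i, j)` with `i ∈ {n−1, n, n+1}`,
`1 ≤ j ≤ min i n`, representing `t_j^{(i)}`. -/
def GammaCond (n : ℕ) (q : ℕ × ℕ) : Prop :=
  (q.1 = n - 1 ∨ q.1 = n ∨ q.1 = n + 1) ∧ 1 ≤ q.2 ∧ q.2 ≤ min q.1 n

instance (n : ℕ) : DecidablePred (GammaCond n) := fun q => by unfold GammaCond; infer_instance

def Gamma (n : ℕ) := {q : ℕ × ℕ // GammaCond n q}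

instance (n : ℕ) : DecidableEq (Gamma n) := Subtype.instDecidableEq

/-- The partial order on `Γ`, generated by `t_j^{(i+1)} ≥ t_j^{(i)}` and
`t_j^{(i)} ≥ t_{j+1}^{(i+1)}`. -/
def GammaLE (n : ℕ) : Gamma n → Gamma n → Prop :=
  Relation.ReflTransGen (fun a b =>
    (b.1.1 = a.1.1 + 1 ∧ b.1.2 = a.1.2) ∨ (a.1.1 = b.1.1 + 1 ∧ a.1.2 = b.1.2 + 1))

/-- Order-decreasing subset (down-set) of `Γ`. -/
def IsDownSet (n : ℕ) (S : Set (Gamma n)) : Prop :=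
  ∀ x ∈ S, ∀ y, GammaLE n y x → y ∈ S

/-- `m_C(k) = #{c ∈ C : c ≤ k}` (1-based labels). -/
def mC (n : ℕ) (C : Finset (Fin (2*n))) (k : ℕ) : ℕ :=
  (C.filter (fun x : Fin (2*n) => (x : ℕ) + 1 ≤ k)).card

/-- `S_C = ∪_k {t_1^{(k)}, …, t_{m_C(k)}^{(k)}} ⊆ Γ`. -/
def SCset (n : ℕ) (C : Finset (Fin (2*n))) : Set (Gamma n) :=
  {q | q.1.2 ≤ mC n C q.1.1}

/-- The characteristic function `χ_{S_C} : Γ → ℕ`. -/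
def chiS (n : ℕ) (C : Finset (Fin (2*n))) : Gamma n → ℕ :=
  fun q => if q.1.2 ≤ mC n C q.1.1 then 1 else 0

/-- `p(Δ) = Σ_i χ_{S_{C_i}}`. -/
def pMap (n : ℕ) (l : List (Finset (Fin (2*n)))) : Gamma n → ℕ :=
  fun q => (l.map (fun C => chiS n C q)).sum

/-- The monoid `𝓟(Γ)` of order-preserving maps `Γ → ℤ_{≥0}`, as an additive submonoid of
`Γ → ℕ` under pointwise addition. -/
def PGamma (n : ℕ) : AddSubmonoid (Gamma n → ℕ) where
  carrier := {p | ∀ x y, GammaLE n x y → p x ≤ p y}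
  add_mem' := fun ha hb x y h => add_le_add (ha x y h) (hb x y h)
  zero_mem' := fun _ _ _ => Nat.zero_le _




section
/-! ### Minors with natural number indices -/

def mJ (x : ℕ → ℕ → ℂ) (i : ℕ) (v : ℕ → ℂ) : ℂ :=
  Matrix.det (Matrix.of fun a b : Fin (i+1) => if (b : ℕ) < i then x b a else v a)

def mK (x : ℕ → ℕ → ℂ) (j : ℕ) (u v : ℕ → ℂ) : ℂ :=
  Matrix.det (Matrix.of fun a b : Fin (j+2) =>
    if (b : ℕ) < j then x b a else if (b : ℕ) = j then u a else v a)

lemma mK_x (x : ℕ → ℕ → ℂ) (j : ℕ) (v : ℕ → ℂ) : mK x j (x j) v = mJ x (j+1) v := by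
  unfold mK mJ
  congr 1
  ext a b
  simp only [Matrix.of_apply]
  split_ifs <;> first | rfl | omega | (simp_all)

lemma mK_swap (x : ℕ → ℕ → ℂ) (j : ℕ) (u v : ℕ → ℂ) : mK x j v u = - mK x j u v := by
  unfold mK
  have hne : (⟨j, by omega⟩ : Fin (j+2)) ≠ ⟨j+1, by omega⟩ := by simp
  have := Matrix.det_permute' (Equiv.swap (⟨j, by omega⟩ : Fin (j+2)) ⟨j+1, by omega⟩)
    (Matrix.of fun a b : Fin (j+2) =>
    if (b : ℕ) < j then x b a else if (b : ℕ) = j then u a else v a)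
  rw [Equiv.Perm.sign_swap hne] at this
  simp only [Units.val_neg, Units.val_one, Int.cast_neg, Int.cast_one, neg_mul, one_mul] at this
  rw [← this]
  congr 1
  ext a b
  simp only [Matrix.of_apply, Matrix.submatrix_apply, id]
  by_cases h1 : b = ⟨j, by omega⟩
  · subst h1; simp
  by_cases h2 : b = ⟨j+1, by omega⟩
  · subst h2; simp
  rw [Equiv.swap_apply_of_ne_of_ne h1 h2]
  have : (b:ℕ) < j := by
    have := b.2
    simp only [Fin.ext_iff] at h1 h2
    omega
  simp [this]

lemma mJ_lin (x : ℕ → ℕ → ℂ) (i : ℕ) : ∃ c : Fin (i+1) → ℂ, ∀ v, mJ x i v = ∑ a, c a * v a := by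
  refine ⟨fun a => Matrix.cramer (Matrix.of fun a b : Fin (i+1) =>
    if (b : ℕ) < i then x b a else 0) (Pi.single a 1) (Fin.last i), fun v => ?_⟩
  have h1 : mJ x i v = Matrix.cramer (Matrix.of fun a b : Fin (i+1) =>
    if (b : ℕ) < i then x b a else 0) (fun a : Fin (i+1) => v a) (Fin.last i) := by
    rw [Matrix.cramer_apply]
    unfold mJ
    congr 1
    ext a b
    simp only [Matrix.of_apply, Matrix.updateCol_apply]
    by_cases h : b = Fin.last i
    · subst h; simp
    · have : (b:ℕ) < i := by
        have := b.2
        simp only [Fin.ext_iff, Fin.val_last] at h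
        omega
      simp [h, this]
  have h2 : (fun a : Fin (i+1) => v a) = ∑ a : Fin (i+1), (v a) • (Pi.single a (1:ℂ) : Fin (i+1) → ℂ) := by
    ext b
    simp [Finset.sum_apply, Pi.single_apply]
  rw [h1, h2, map_sum, Finset.sum_apply]
  refine Finset.sum_congr rfl fun a _ => ?_
  rw [map_smul, Pi.smul_apply, smul_eq_mul, mul_comm]

lemma mJ_x_zero (x : ℕ → ℕ → ℂ) (i b : ℕ) (hb : b < i) : mJ x i (x b) = 0 := by
  unfold mJ
  refine Matrix.det_zero_of_column_eq (i := ⟨b, by omega⟩) (j := ⟨i, by omega⟩) ?_ ?_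
  · simp only [ne_eq, Fin.mk.injEq]; omega
  · intro k
    simp [hb]

lemma pluecker_aux (x : ℕ → ℕ → ℂ) (j : ℕ) (a b c : ℕ → ℂ) :
    mK x j b c * mJ x j a = mK x j a c * mJ x j b + mK x j b a * mJ x j c := by
  obtain ⟨l, hl⟩ := mJ_lin (fun p q => x p q) j
  set A : Matrix (Fin (j+2)) (Fin (j+2)) ℂ := (Matrix.of fun s t : Fin (j+2) =>
    if (t : ℕ) < j then x t s else if (t : ℕ) = j then b s else c s) with hA
  have hc := Matrix.mulVec_cramer A (fun s => a s)
  set y := Matrix.cramer A (fun s => a s) with hy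
  have hyb : y ⟨j, by omega⟩ = mK x j a c := by
    rw [hy, Matrix.cramer_apply]
    unfold mK
    congr 1
    ext s t
    simp only [hA, Matrix.of_apply, Matrix.updateCol_apply, Fin.ext_iff]
    split_ifs <;> first | rfl | omega
  have hyc : y ⟨j+1, by omega⟩ = mK x j b a := by
    rw [hy, Matrix.cramer_apply]
    unfold mK
    congr 1
    ext s t
    have := t.2
    simp only [hA, Matrix.of_apply, Matrix.updateCol_apply, Fin.ext_iff]
    split_ifs <;> first | rfl | omega
  have hd : A.det = mK x j b c := rfl
  have key : ∑ s : Fin (j+1), l s * (A.mulVec y (Fin.castSucc s)) =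
      ∑ s : Fin (j+1), l s * (A.det * a s) := by
    rw [hc]; simp
  have e1 : ∑ s : Fin (j+1), l s * (A.det * a s) = mK x j b c * mJ x j a := by
    rw [hl, hd, Finset.mul_sum]
    exact Finset.sum_congr rfl fun s _ => by ring
  have e2 : ∑ s : Fin (j+1), l s * (A.mulVec y (Fin.castSucc s)) =
      ∑ t : Fin (j+2), y t * mJ x j (if (t : ℕ) < j then x t else if (t : ℕ) = j then b else c) := by
    simp only [hl, Matrix.mulVec, dotProduct, Finset.mul_sum]
    rw [Finset.sum_comm]
    refine Finset.sum_congr rfl fun t _ => Finset.sum_congr rfl fun s _ => ?_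
    have : A (Fin.castSucc s) t = (if (t : ℕ) < j then x t else if (t : ℕ) = j then b else c) s := by
      simp only [hA, Matrix.of_apply, Fin.val_castSucc]
      split_ifs <;> rfl
    rw [this]; ring
  rw [← e1, ← key, e2, Fin.sum_univ_castSucc, Fin.sum_univ_castSucc]
  have z : ∑ i : Fin j, y (Fin.castSucc (Fin.castSucc i)) * mJ x j
      (if ((Fin.castSucc (Fin.castSucc i) : Fin (j+2)) : ℕ) < j then
        x ((Fin.castSucc (Fin.castSucc i) : Fin (j+2)) : ℕ)
        else if ((Fin.castSucc (Fin.castSucc i) : Fin (j+2)) : ℕ) = j then b else c) = 0 := by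
    refine Finset.sum_eq_zero fun i _ => ?_
    have hi := i.2
    simp only [Fin.val_castSucc, hi, if_true]
    rw [mJ_x_zero x j i hi, mul_zero]
  rw [z, zero_add, ← hyb, ← hyc]
  simp only [Fin.val_castSucc, Fin.val_last]
  simp only [lt_irrefl, if_false, if_true, show ¬ (j + 1 < j) by omega, show ¬ (j+1 = j) by omega]
  rfl

/-- the three term relation -/
lemma pluecker (x : ℕ → ℕ → ℂ) (k : ℕ) (p q : ℕ → ℂ) :
    mJ x k (x k) * mK x k p q = mJ x k p * mJ x (k+1) q - mJ x k q * mJ x (k+1) p := by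
  have h := pluecker_aux x k (x k) p q
  rw [mK_x, mK_swap x k (x k) p, mK_x] at h
  rw [mul_comm, h]; ring

/-- triangular evaluation -/
lemma mJ_diag (x : ℕ → ℕ → ℂ) (i : ℕ) (v : ℕ → ℂ) (t : ℕ → ℂ)
    (hx : ∀ b < i, ∀ a, x b a = if a = b then t b else 0) :
    mJ x i v = (∏ b ∈ Finset.range i, t b) * v i := by
  unfold mJ
  rw [Matrix.det_of_isUpperTriangular]
  · rw [Fin.prod_univ_castSucc, Finset.prod_range]
    congr 1
    · refine Finset.prod_congr rfl fun b _ => ?_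
      have := b.2
      simp [this, hx b this]
    · simp
  · intro a b hab
    have h : (b:ℕ) < a := hab
    have := a.2
    simp only [Matrix.of_apply]
    rw [if_pos (by omega), hx _ (by omega), if_neg (by omega)]

lemma mJ_arrow (x : ℕ → ℕ → ℂ) (i : ℕ) (v : ℕ → ℂ) (t w : ℕ → ℂ)
    (hx : ∀ b < i, ∀ a, x b a = if a = 0 then w b else if a = b + 1 then t (b+1) else 0)
    (hv : ∀ a, 0 < a → a ≤ i → v a = 0) :
    mJ x i v = (-1)^i * v 0 * ∏ b ∈ Finset.range i, t (b+1) := by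
  unfold mJ
  set A : Matrix (Fin (i+1)) (Fin (i+1)) ℂ :=
    (Matrix.of fun a b : Fin (i+1) => if (b : ℕ) < i then x b a else v a) with hA
  have hp := Matrix.det_permute' (finRotate (i+1)).symm A
  have hs : Equiv.Perm.sign (finRotate (i+1)).symm = (-1)^i := by
    rw [Equiv.Perm.sign_symm, sign_finRotate]; simp
  rw [hs] at hp
  have h2 : A.det = (-1)^i * (A.submatrix id (finRotate (i+1)).symm).det := by
    rw [hp]
    push_cast
    rw [← mul_assoc, ← pow_add, ← two_mul, pow_mul]; simp
  rw [h2, Matrix.det_of_isUpperTriangular, mul_assoc]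
  · congr 1
    rw [Fin.prod_univ_succ, Finset.prod_range]
    have hz : (finRotate (i+1)).symm 0 = Fin.last i := by
      rw [Equiv.symm_apply_eq, finRotate_last]
    have hsu : ∀ b : Fin i, (finRotate (i+1)).symm b.succ = b.castSucc := by
      intro b
      rw [Equiv.symm_apply_eq]
      exact (finRotate_of_lt b.2).symm
    congr 1
    · simp [hA, hz]
    · refine Finset.prod_congr rfl fun b _ => ?_
      simp only [Matrix.submatrix_apply, id, hsu, hA, Matrix.of_apply, Fin.val_castSucc, b.2,
        if_true, Fin.val_succ]
      rw [hx _ b.2]; simp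
  · intro a b hab
    have h : (b:ℕ) < a := hab
    have ha := a.2
    simp only [Matrix.submatrix_apply, id]
    rcases Fin.eq_zero_or_eq_succ b with rfl | ⟨c, rfl⟩
    · have hz : (finRotate (i+1)).symm 0 = Fin.last i := by
        rw [Equiv.symm_apply_eq, finRotate_last]
      rw [hz]
      simp only [hA, Matrix.of_apply, Fin.val_last, lt_irrefl, if_false]
      exact hv _ (by simpa using h) (by omega)
    · have hsu : (finRotate (i+1)).symm c.succ = c.castSucc := by
        rw [Equiv.symm_apply_eq]
        exact (finRotate_of_lt c.2).symm
      rw [hsu]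
      simp only [Fin.val_succ] at h
      simp only [hA, Matrix.of_apply, Fin.val_castSucc, c.2, if_true]
      rw [hx _ c.2, if_neg (by omega), if_neg (by omega)]

lemma mK_last (x : ℕ → ℕ → ℂ) (j : ℕ) (u v : ℕ → ℂ) (hx : ∀ b < j, x b (j+1) = 0)
    (hu : u (j+1) = 0) : mK x j u v = v (j+1) * mJ x j u := by
  unfold mK mJ
  rw [Matrix.det_succ_row _ (Fin.last (j+1)), Fin.sum_univ_castSucc, Finset.sum_eq_zero, zero_add]
  · have : ((-1:ℂ) ^ ((Fin.last (j+1) : ℕ) + (Fin.last (j+1) : ℕ))) = 1 := by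
      rw [← two_mul, pow_mul]; simp
    rw [this, one_mul]
    congr 1
    · simp
    · congr 1
      ext a b
      have := b.2
      simp only [Matrix.submatrix_apply, Matrix.of_apply, Fin.succAbove_last, Fin.val_castSucc]
      split_ifs <;> first | rfl | omega
  · intro b _
    have hb := b.2
    simp only [Matrix.of_apply, Fin.val_last, Fin.val_castSucc]
    split_ifs with h1 h2
    · rw [hx _ h1]; simp
    · rw [hu]; simp
    · omega

end

section
/-! ### Labels of the poset -/

abbrev Lab (n : ℕ) := (Fin n ⊕ Fin n) ⊕ (Fin (n-1) ⊕ Fin (n-1))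

def lset (n : ℕ) : Lab n → Finset (Fin (2*n))
  | .inl (.inl i) => Jset n i
  | .inl (.inr i) => JPset n i
  | .inr (.inl k) => Iset n (k+1)
  | .inr (.inr k) => Kset n k

def lrank (n : ℕ) : Lab n → ℕ
  | .inl (.inl i) => 3 * (n - 1 - i)
  | .inl (.inr i) => 3 * (n - 1 - i) + 1
  | .inr (.inl k) => 3 * (n - 2 - k) + 2
  | .inr (.inr k) => 3 * (n - 2 - k) + 2

lemma lset_range (n : ℕ) (hn : 2 ≤ n) (C : Finset (Fin (2*n))) :
    C ∈ LSet n ↔ ∃ c, lset n c = C := by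
  constructor
  · rintro (⟨i, h1, h2, rfl⟩ | ⟨j, h, rfl⟩ | ⟨j, h, rfl⟩ | ⟨k, h, rfl⟩)
    · exact ⟨.inr (.inl ⟨i-1, by omega⟩), by simp only [lset]; congr 1; omega⟩
    · exact ⟨.inl (.inl ⟨j, by omega⟩), rfl⟩
    · exact ⟨.inl (.inr ⟨j, by omega⟩), rfl⟩
    · exact ⟨.inr (.inr ⟨k, by omega⟩), rfl⟩
  · rintro ⟨((i|i)|(k|k)), rfl⟩
    · exact Or.inr (Or.inl ⟨i, by omega, rfl⟩)
    · exact Or.inr (Or.inr (Or.inl ⟨i, by omega, rfl⟩))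
    · exact Or.inl ⟨k+1, by omega, by omega, rfl⟩
    · exact Or.inr (Or.inr (Or.inr ⟨k, by omega, rfl⟩))

lemma lset_inj (n : ℕ) (hn : 2 ≤ n) : Function.Injective (lset n) := by
  intro c d h
  have hm : ∀ x : ℕ, ∀ hx : x < 2*n, ((⟨x, hx⟩ : Fin (2*n)) ∈ lset n c ↔ (⟨x, hx⟩ : Fin (2*n)) ∈ lset n d) := by
    intro x hx; rw [h]
  have h1 := hm (n-1) (by omega)
  have h2 := hm n (by omega)
  rcases c with ((i|i)|(k|k)) <;> rcases d with ((j|j)|(l|l)) <;>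
    simp only [lset, Jset, JPset, Iset, Kset, Finset.mem_filter, Finset.mem_univ, true_and] at hm h1 h2 <;>
    first
    | (exfalso; have h3 := hm n (by omega); omega)
    | (have : i = j := by
         have ai := hm i (by omega)
         have aj := hm j (by omega)
         ext
         omega
       rw [this])
    | (have : k = l := by
         have ai := hm k (by omega)
         have aj := hm l (by omega)
         ext
         omega
       rw [this])

lemma LGen_rank (n : ℕ) (hn : 2 ≤ n) (C D : Finset (Fin (2*n))) (h : LGen n C D) :
    ∃ c d, lset n c = C ∧ lset n d = D ∧ lrank n c < lrank n d := by
  obtain ⟨i, h1, h2, h⟩ := h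
  rcases h with ⟨rfl, rfl⟩ | ⟨rfl, rfl⟩ | ⟨rfl, rfl⟩ | ⟨rfl, rfl⟩ | ⟨rfl, rfl⟩ | ⟨rfl, rfl⟩
  · exact ⟨.inl (.inl ⟨i, by omega⟩), .inl (.inr ⟨i, by omega⟩), rfl, rfl, by simp [lrank]⟩
  · exact ⟨.inl (.inr ⟨i, by omega⟩), .inr (.inl ⟨i-1, by omega⟩), rfl,
      by simp only [lset]; congr 1; omega, by simp only [lrank]; omega⟩
  · exact ⟨.inl (.inr ⟨i, by omega⟩), .inr (.inr ⟨i-1, by omega⟩), rfl, rfl,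
      by simp only [lrank]; omega⟩
  · exact ⟨.inr (.inl ⟨i-1, by omega⟩), .inl (.inl ⟨i-1, by omega⟩),
      by simp only [lset]; congr 1; omega, rfl, by simp only [lrank]; omega⟩
  · exact ⟨.inr (.inr ⟨i-1, by omega⟩), .inl (.inl ⟨i-1, by omega⟩), rfl, rfl,
      by simp only [lrank]; omega⟩
  · exact ⟨.inl (.inl ⟨i-1, by omega⟩), .inl (.inr ⟨i-1, by omega⟩), rfl, rfl, by simp [lrank]⟩

lemma LLE_rank (n : ℕ) (hn : 2 ≤ n) (c d : Lab n) (h : LLE n (lset n c) (lset n d)) :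
    c = d ∨ lrank n c < lrank n d := by
  have key : ∀ D, Relation.ReflTransGen (LGen n) (lset n c) D →
      ∀ d, lset n d = D → c = d ∨ lrank n c < lrank n d := by
    intro D hD
    induction hD with
    | refl => intro d hd; left; exact (lset_inj n hn hd).symm
    | tail _ h2 ih =>
      intro d hd
      obtain ⟨a, b, ha, hb, hab⟩ := LGen_rank n hn _ _ h2
      have := lset_inj n hn (hd.trans hb.symm)
      subst this
      right
      rcases ih a ha with rfl | h
      · exact hab
      · omega
  exact key _ h d rfl

lemma LLE_J_JP (n : ℕ) (hn : 2 ≤ n) (i : ℕ) (hi : i < n) : LLE n (Jset n i) (JPset n i) := by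
  apply Relation.ReflTransGen.single
  rcases Nat.eq_zero_or_pos i with rfl | h
  · exact ⟨1, le_refl _, by omega, by simp⟩
  · exact ⟨i, h, by omega, by simp⟩

lemma LLE_JP_I (n : ℕ) (k : ℕ) (hk : k < n - 1) : LLE n (JPset n (k+1)) (Iset n (k+1)) :=
  Relation.ReflTransGen.single ⟨k+1, by omega, by omega, by simp⟩

lemma LLE_JP_K (n : ℕ) (k : ℕ) (hk : k < n - 1) : LLE n (JPset n (k+1)) (Kset n k) :=
  Relation.ReflTransGen.single ⟨k+1, by omega, by omega, by simp⟩

lemma LLE_I_J (n : ℕ) (k : ℕ) (hk : k < n - 1) : LLE n (Iset n (k+1)) (Jset n k) :=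
  Relation.ReflTransGen.single ⟨k+1, by omega, by omega, by simp⟩

lemma LLE_K_J (n : ℕ) (k : ℕ) (hk : k < n - 1) : LLE n (Kset n k) (Jset n k) :=
  Relation.ReflTransGen.single ⟨k+1, by omega, by omega, by simp⟩

lemma LLE_trans {n : ℕ} {A B C : Finset (Fin (2*n))} (h : LLE n A B) (h' : LLE n B C) : LLE n A C :=
  Relation.ReflTransGen.trans h h'

lemma LLE_J_J (n : ℕ) (hn : 2 ≤ n) (i j : ℕ) (hij : i ≤ j) (hj : j < n) :
    LLE n (Jset n j) (Jset n i) := by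
  induction j, hij using Nat.le_induction with
  | base => exact Relation.ReflTransGen.refl
  | succ k hk ih =>
    exact LLE_trans (LLE_J_JP n hn (k+1) hj) (LLE_trans (LLE_JP_I n k (by omega))
      (LLE_trans (LLE_I_J n k (by omega)) (ih (by omega))))

lemma LLE_of_rank (n : ℕ) (hn : 2 ≤ n) (c d : Lab n) (h : lrank n c < lrank n d) :
    LLE n (lset n c) (lset n d) := by
  -- everything is below the J of its floor
  have low : ∀ d : Lab n, ∃ i : ℕ, i < n ∧ lrank n d < 3 * (n - 1 - i) + 3 ∧ 3 * (n - 1 - i) ≤ lrank n d ∧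
      LLE n (Jset n i) (lset n d) := by
    rintro ((i|i)|(k|k))
    · exact ⟨i, i.2, by simp [lrank], by simp [lrank], Relation.ReflTransGen.refl⟩
    · exact ⟨i, i.2, by simp [lrank], by simp [lrank], LLE_J_JP n hn i i.2⟩
    · exact ⟨k+1, by omega, by simp only [lrank]; omega, by simp only [lrank]; omega,
        LLE_trans (LLE_J_JP n hn (k+1) (by omega)) (LLE_JP_I n k k.2)⟩
    · exact ⟨k+1, by omega, by simp only [lrank]; omega, by simp only [lrank]; omega,
        LLE_trans (LLE_J_JP n hn (k+1) (by omega)) (LLE_JP_K n k k.2)⟩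
  have high : ∀ c : Lab n, ∀ i : ℕ, i < n → lrank n c < 3 * (n - 1 - i) → LLE n (lset n c) (Jset n i) := by
    have hh : ∀ j : ℕ, ∀ i, i < j → j < n → LLE n (JPset n j) (Jset n i) := by
      intro j i hij hj
      obtain ⟨k, rfl⟩ : ∃ k, j = k + 1 := ⟨j-1, by omega⟩
      exact LLE_trans (LLE_JP_I n k (by omega)) (LLE_trans (LLE_I_J n k (by omega))
        (LLE_J_J n hn i k (by omega) (by omega)))
    rintro ((j|j)|(k|k)) i hi hc <;> simp only [lrank] at hc
    · exact LLE_J_J n hn i j (by omega) j.2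
    · exact hh j i (by omega) j.2
    · exact LLE_trans (LLE_I_J n k k.2) (LLE_J_J n hn i k (by omega) (by omega))
    · exact LLE_trans (LLE_K_J n k k.2) (LLE_J_J n hn i k (by omega) (by omega))
  obtain ⟨i, hi, h1, h2, h3⟩ := low d
  by_cases hc : lrank n c < 3 * (n - 1 - i)
  · exact LLE_trans (high c i hi hc) h3
  · -- same floor
    rcases c with ((a|a)|(a|a)) <;> rcases d with ((b|b)|(b|b)) <;> simp only [lrank] at h h1 h2 hc <;>
      first
      | (exfalso; omega)
      | skip
    · have : b = a := by ext; omega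
      subst this
      exact LLE_J_JP n hn _ b.2
    · have : (a:ℕ) = b+1 := by omega
      simp only [lset, this]
      exact LLE_trans (LLE_J_JP n hn _ (by omega)) (LLE_JP_I n b b.2)
    · have : (a:ℕ) = b+1 := by omega
      simp only [lset, this]
      exact LLE_trans (LLE_J_JP n hn _ (by omega)) (LLE_JP_K n b b.2)
    · have : (a:ℕ) = b+1 := by omega
      simp only [lset, this]
      exact (LLE_JP_I n b b.2)
    · have : (a:ℕ) = b+1 := by omega
      simp only [lset, this]
      exact (LLE_JP_K n b b.2)

/-! ### Exponents -/

def ecount (n : ℕ) (l : List (Finset (Fin (2*n)))) (c : Lab n) : ℕ := l.count (lset n c)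

def Good (n : ℕ) (e : Lab n → ℕ) : Prop :=
  ∀ k : Fin (n-1), e (.inr (.inl k)) = 0 ∨ e (.inr (.inr k)) = 0

def mono (n : ℕ) (e : Lab n → ℕ) (X : Matrix (Fin (2*n)) (Fin (2*n)) ℂ) : ℂ :=
  ∏ c, deltaFn n (lset n c) X ^ e c

lemma mono_add_single (n : ℕ) (e : Lab n → ℕ) (c : Lab n) (X) :
    mono n (e + Pi.single c 1) X = deltaFn n (lset n c) X * mono n e X := by
  unfold mono
  simp only [Pi.add_apply, pow_add, Finset.prod_mul_distrib]
  rw [mul_comm]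
  congr 1
  rw [Finset.prod_eq_single c]
  · simp
  · intro b _ hb; simp [hb]
  · simp

lemma std_eq_mono (n : ℕ) (hn : 2 ≤ n) (l : List (Finset (Fin (2*n)))) (hl : ∀ C ∈ l, C ∈ LSet n) (X) :
    stdMonomial n l X = mono n (ecount n l) X := by
  induction l with
  | nil => simp [stdMonomial, mono, ecount]
  | cons C l ih =>
    obtain ⟨c, rfl⟩ := (lset_range n hn C).1 (hl C (by simp))
    have : ecount n (lset n c :: l) = ecount n l + Pi.single c 1 := by
      ext d
      simp only [ecount, List.count_cons, Pi.add_apply, Pi.single_apply, beq_iff_eq]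
      congr 1
      by_cases h : d = c
      · simp [h]
      · have : lset n c ≠ lset n d := fun h' => h (lset_inj n hn h').symm
        simp [h, this]
    rw [this, mono_add_single, ← ih (fun C hC => hl C (by simp [hC]))]
    simp [stdMonomial]

lemma multichain_pairwise {n : ℕ} {l : List (Finset (Fin (2*n)))} (h : IsMultichain n l) :
    l.Pairwise (LLE n) := by
  have h2 := h.2
  have : IsTrans (Finset (Fin (2*n))) (LLE n) := ⟨fun _ _ _ => LLE_trans⟩
  exact (List.isChain_iff_pairwise).1 h2

lemma multichain_good (n : ℕ) (hn : 2 ≤ n) (l : List (Finset (Fin (2*n)))) (h : IsMultichain n l) :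
    Good n (ecount n l) := by
  intro k
  by_contra hc
  push Not at hc
  simp only [ecount, ne_eq, List.count_eq_zero, not_not] at hc
  have hp := multichain_pairwise h
  have hne : lset n (.inr (.inl k)) ≠ lset n (.inr (.inr k)) := fun h => by
    have := lset_inj n hn h
    simp at this
  have hcomp : LLE n (lset n (.inr (.inl k))) (lset n (.inr (.inr k))) ∨
      LLE n (lset n (.inr (.inr k))) (lset n (.inr (.inl k))) := by
    have hq : l.Pairwise (fun A B => LLE n A B ∨ LLE n B A) := hp.imp (fun h => Or.inl h)
    have : Std.Symm (fun A B => LLE n A B ∨ LLE n B A) := ⟨fun a b h => h.symm⟩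
    exact List.Pairwise.forall_of_forall (R := fun A B => LLE n A B ∨ LLE n B A) (fun a _ => Or.inl Relation.ReflTransGen.refl) hq hc.1 hc.2
  rcases hcomp with h | h
  · have := LLE_rank n hn _ _ h
    simp [lrank] at this
  · have := LLE_rank n hn _ _ h
    simp [lrank] at this

lemma multichain_inj (n : ℕ) (hn : 2 ≤ n) (l l' : List (Finset (Fin (2*n)))) (h : IsMultichain n l)
    (h' : IsMultichain n l') (he : ecount n l = ecount n l') : l = l' := by
  have hp : l.Perm l' := by
    rw [List.perm_iff_count]
    intro C
    by_cases hC : C ∈ LSet n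
    · obtain ⟨c, rfl⟩ := (lset_range n hn C).1 hC
      exact congrFun he c
    · rw [List.count_eq_zero_of_not_mem (fun h1 => hC (h.1 _ h1)),
        List.count_eq_zero_of_not_mem (fun h1 => hC (h'.1 _ h1))]
  refine hp.eq_of_pairwise ?_ (multichain_pairwise h) (multichain_pairwise h')
  intro A B hA hB hAB hBA
  obtain ⟨a, rfl⟩ := (lset_range n hn A).1 (h.1 _ hA)
  obtain ⟨b, rfl⟩ := (lset_range n hn B).1 (h'.1 _ hB)
  rcases LLE_rank n hn _ _ hAB with rfl | h1
  · rfl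
  rcases LLE_rank n hn _ _ hBA with rfl | h2
  · rfl
  omega

lemma multichain_exists (n : ℕ) (hn : 2 ≤ n) (e : Lab n → ℕ) (he : Good n e) :
    ∃ l, IsMultichain n l ∧ ecount n l = e := by
  let s : Multiset (Lab n) := ∑ c, Multiset.replicate (e c) c
  have hs : ∀ c, s.count c = e c := by
    intro c
    simp only [s, Multiset.count_sum', Multiset.count_replicate]
    simp
  obtain ⟨l0, hl0⟩ : ∃ l0 : List (Lab n), (l0 : Multiset (Lab n)) = s := Quot.exists_rep s
  let r : Lab n → Lab n → Prop := fun c d => lrank n c ≤ lrank n d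
  have : DecidableRel r := fun c d => Nat.decLe _ _
  have : Std.Total r := ⟨fun a b => Nat.le_total _ _⟩
  have : IsTrans _ r := ⟨fun a b c h1 h2 => Nat.le_trans h1 h2⟩
  let l1 := l0.insertionSort r
  have hperm : l1.Perm l0 := List.perm_insertionSort r l0
  have hsort : l1.Pairwise r := List.pairwise_insertionSort r l0
  have hcount : ∀ c, Multiset.count c (l1 : Multiset (Lab n)) = e c := by
    intro c
    rw [Multiset.coe_eq_coe.2 hperm, hl0, hs]
  refine ⟨l1.map (lset n), ⟨?_, ?_⟩, ?_⟩
  · intro C hC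
    obtain ⟨c, _, rfl⟩ := List.mem_map.1 hC
    exact (lset_range n hn _).2 ⟨c, rfl⟩
  · show List.IsChain _ _
    have : IsTrans (Finset (Fin (2*n))) (LLE n) := ⟨fun _ _ _ => LLE_trans⟩
    rw [List.isChain_iff_pairwise, List.pairwise_map]
    refine hsort.imp_of_mem ?_
    intro c d hc hd hcd
    rcases Nat.lt_or_eq_of_le hcd with h | h
    · exact LLE_of_rank n hn c d h
    · have hc' : e c ≠ 0 := by rw [← hcount]; exact (Multiset.count_pos.2 (Multiset.mem_coe.2 hc)).ne'
      have hd' : e d ≠ 0 := by rw [← hcount]; exact (Multiset.count_pos.2 (Multiset.mem_coe.2 hd)).ne'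
      have : c = d := by
        rcases c with ((a|a)|(a|a)) <;> rcases d with ((b|b)|(b|b)) <;> simp only [lrank] at h <;>
        first
        | (exfalso; omega)
        | (congr 2; ext; omega)
        | (exfalso
           have : a = b := by ext; omega
           subst this
           have := he a
           omega)
      rw [this]
      exact Relation.ReflTransGen.refl
  · ext c
    simp only [ecount]
    rw [← hcount c, ← Multiset.coe_count, ← Multiset.map_coe, Multiset.count_map_eq_count' _ _ (lset_inj n hn)]

end

section
/-! ### The functions delta -/

abbrev Mat (n : ℕ) := Matrix (Fin (2*n)) (Fin (2*n)) ℂ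

/-- column `b` as a function of the row index -/
def col {n : ℕ} (X : Mat n) (b a : ℕ) : ℂ :=
  if h : a < 2*n ∧ b < 2*n then X ⟨a, h.1⟩ ⟨b, h.2⟩ else 0

lemma deltaFn_eq (n r : ℕ) (C : Finset (Fin (2*n))) (hr : r ≤ 2*n) (e : Fin r → Fin (2*n)) (he : StrictMono e)
    (hC : ∀ x, x ∈ C ↔ ∃ b, e b = x) (X : Mat n) :
    deltaFn n C X = Matrix.det (Matrix.of fun a b : Fin r => X (Fin.castLE hr a) (e b)) := by
  have hcard : C.card = r := by
    have : C = Finset.univ.map ⟨e, he.injective⟩ := by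
      ext x; simp [hC]
    rw [this]; simp
  subst hcard
  unfold deltaFn
  congr 1
  ext a b
  simp only [Matrix.of_apply]
  have h := Finset.orderEmbOfFin_unique (s := C) rfl (f := e) (fun x => (hC _).2 ⟨x, rfl⟩) he
  rw [h]
  rfl

lemma labCols (n : ℕ) (hn : 2 ≤ n) : (c : Lab n) → ∃ r, ∃ _ : r ≤ 2*n, ∃ e : Fin r → Fin (2*n), StrictMono e ∧
    (∀ x, x ∈ lset n c ↔ ∃ b, e b = x) := by
  intro c
  refine ⟨(lset n c).card, by simpa using (lset n c).card_le_univ, (lset n c).orderEmbOfFin rfl, 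
    (OrderEmbedding.strictMono _), fun x => ?_⟩
  have := Finset.range_orderEmbOfFin (lset n c) rfl
  have h2 : x ∈ Set.range ((lset n c).orderEmbOfFin rfl) ↔ x ∈ lset n c := by rw [this]; simp
  rw [← h2]; rfl

lemma delta_J (n i : ℕ) (hi : i < n) (X : Mat n) :
    deltaFn n (Jset n i) X = mJ (col X) i (col X (n-1)) := by
  rw [deltaFn_eq n (i+1) (Jset n i) (by omega) (fun b => if (b:ℕ) < i then ⟨b, by omega⟩ else ⟨n-1, by omega⟩)]
  · unfold mJ
    congr 1
    ext a b
    have ha := a.2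
    simp only [Matrix.of_apply, col]
    split_ifs <;> first | rfl | omega
  · intro a b hab
    have : (a:ℕ) < b := hab
    have hb := b.2
    simp only
    split_ifs <;> simp only [Fin.lt_def] <;> omega
  · intro x
    simp only [Jset, Finset.mem_filter, Finset.mem_univ, true_and]
    constructor
    · rintro (h | h)
      · exact ⟨⟨x, by omega⟩, by simp only; rw [if_pos (by omega)]⟩
      · exact ⟨⟨i, by omega⟩, by simp only [lt_irrefl, if_false]; ext; simp only; omega⟩
    · rintro ⟨b, rfl⟩
      split_ifs with h
      · left; simp only; omega
      · right; simp only; omega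

lemma delta_JP (n i : ℕ) (hi : i < n) (X : Mat n) :
    deltaFn n (JPset n i) X = mJ (col X) i (col X n) := by
  rw [deltaFn_eq n (i+1) (JPset n i) (by omega) (fun b => if (b:ℕ) < i then ⟨b, by omega⟩ else ⟨n, by omega⟩)]
  · unfold mJ
    congr 1
    ext a b
    have ha := a.2
    simp only [Matrix.of_apply, col]
    split_ifs <;> first | rfl | omega
  · intro a b hab
    have : (a:ℕ) < b := hab
    have hb := b.2
    simp only
    split_ifs <;> simp only [Fin.lt_def] <;> omega
  · intro x
    simp only [JPset, Finset.mem_filter, Finset.mem_univ, true_and]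
    constructor
    · rintro (h | h)
      · exact ⟨⟨x, by omega⟩, by simp only; rw [if_pos (by omega)]⟩
      · exact ⟨⟨i, by omega⟩, by simp only [lt_irrefl, if_false]; ext; simp only; omega⟩
    · rintro ⟨b, rfl⟩
      split_ifs with h
      · left; simp only; omega
      · right; simp only

lemma delta_I (n k : ℕ) (hk : k < n - 1) (X : Mat n) :
    deltaFn n (Iset n (k+1)) X = mJ (col X) k (col X k) := by
  rw [deltaFn_eq n (k+1) (Iset n (k+1)) (by omega) (fun b => ⟨b, by omega⟩)]
  · unfold mJ
    congr 1
    ext a b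
    have ha := a.2
    have hb := b.2
    simp only [Matrix.of_apply, col]
    split_ifs <;> first | omega | rfl | skip
    have : (b:ℕ) = k := by omega
    simp only [this]; rfl
  · intro a b hab
    exact hab
  · intro x
    simp only [Iset, Finset.mem_filter, Finset.mem_univ, true_and]
    constructor
    · intro h
      exact ⟨⟨x, by omega⟩, rfl⟩
    · rintro ⟨b, rfl⟩
      simp only; omega

lemma delta_K (n k : ℕ) (hk : k < n - 1) (X : Mat n) :
    deltaFn n (Kset n k) X = mK (col X) k (col X (n-1)) (col X n) := by
  rw [deltaFn_eq n (k+2) (Kset n k) (by omega)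
    (fun b => if (b:ℕ) < k then ⟨b, by omega⟩ else if (b:ℕ) = k then ⟨n-1, by omega⟩ else ⟨n, by omega⟩)]
  · unfold mK
    congr 1
    ext a b
    have ha := a.2
    simp only [Matrix.of_apply, col]
    split_ifs <;> first | rfl | omega
  · intro a b hab
    have : (a:ℕ) < b := hab
    have hb := b.2
    simp only
    split_ifs <;> simp only [Fin.lt_def] <;> omega
  · intro x
    simp only [Kset, Finset.mem_filter, Finset.mem_univ, true_and]
    constructor
    · rintro (h | h | h)
      · exact ⟨⟨x, by omega⟩, by simp only; rw [if_pos (by omega)]⟩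
      · exact ⟨⟨k, by omega⟩, by simp only [lt_irrefl, if_false, if_true]; ext; simp only; omega⟩
      · exact ⟨⟨k+1, by omega⟩, by
          simp only [show ¬ (k+1 < k) by omega, show ¬ (k+1 = k) by omega, if_false]; ext; simp only; omega⟩
    · rintro ⟨b, rfl⟩
      split_ifs with h h
      · left; simp only; omega
      · right; left; simp only; omega
      · right; right; simp only

lemma delta_rel (n k : ℕ) (hk : k < n - 1) (X : Mat n) :
    deltaFn n (Iset n (k+1)) X * deltaFn n (Kset n k) X =
      deltaFn n (Jset n k) X * deltaFn n (JPset n (k+1)) X -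
      deltaFn n (JPset n k) X * deltaFn n (Jset n (k+1)) X := by
  rw [delta_I n k hk, delta_K n k hk, delta_J n k (by omega), delta_J n (k+1) (by omega),
    delta_JP n k (by omega), delta_JP n (k+1) (by omega), pluecker]

/-- the delta of a label -/
def dl (n : ℕ) (c : Lab n) (X : Mat n) : ℂ := deltaFn n (lset n c) X

lemma dl_left (n : ℕ) (hn : 2 ≤ n) (c : Lab n) (w X : Mat n) (h0 : ∀ i j, i < j → w i j = 0)
    (h1 : ∀ i, w i i = 1) : dl n c (w * X) = dl n c X := by
  obtain ⟨r, hr, e, he, hC⟩ := labCols n hn c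
  unfold dl
  rw [deltaFn_eq n r _ hr e he hC, deltaFn_eq n r _ hr e he hC]
  have : (Matrix.of fun a b : Fin r => (w * X) (Fin.castLE hr a) (e b)) =
      (Matrix.of fun a b : Fin r => w (Fin.castLE hr a) (Fin.castLE hr b)) *
      (Matrix.of fun a b : Fin r => X (Fin.castLE hr a) (e b)) := by
    ext a b
    simp only [Matrix.of_apply, Matrix.mul_apply]
    symm
    refine Fintype.sum_of_injective (Fin.castLE hr) (Fin.castLE_injective hr) _ _ ?_ (fun _ => rfl)
    intro i hi
    have : (a:ℕ) < i := by
      by_contra hcon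
      exact hi ⟨⟨i, by omega⟩, rfl⟩
    rw [h0 _ _ (show Fin.castLE hr a < i from this), zero_mul]
  rw [this, Matrix.det_mul, Matrix.det_of_isLowerTriangular]
  · simp [h1]
  · intro a b hab
    exact h0 _ _ (show (a:ℕ) < b from hab)

lemma dl_right (n : ℕ) (hn : 2 ≤ n) (c : Lab n) (v X : Mat n) (hv : v ∈ Un1Set n) :
    dl n c (X * v) = dl n c X := by
  obtain ⟨r, hr, e, he, hC⟩ := labCols n hn c
  unfold dl
  rw [deltaFn_eq n r _ hr e he hC, deltaFn_eq n r _ hr e he hC]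
  obtain ⟨_, hl, h1, hs⟩ := hv
  have hz : ∀ k d : Fin (2*n), d ∈ lset n c → k ∉ lset n c → v k d = 0 := by
    intro k d hd hk
    have hkd : k ≠ d := fun h => hk (h ▸ hd)
    by_cases hdn : (d:ℕ) + 1 = n ∨ (d:ℕ) = n
    · rw [hs k d (by tauto), if_neg hkd]
    · apply hl
      rw [Fin.lt_def]
      push Not at hdn
      rcases c with ((i|i)|(i|i)) <;>
        simp only [lset, Jset, JPset, Iset, Kset, Finset.mem_filter, Finset.mem_univ, true_and] at hd hk <;> omega
  have : (Matrix.of fun a b : Fin r => (X * v) (Fin.castLE hr a) (e b)) =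
      (Matrix.of fun a b : Fin r => X (Fin.castLE hr a) (e b)) *
      (Matrix.of fun a b : Fin r => v (e a) (e b)) := by
    ext a b
    simp only [Matrix.of_apply, Matrix.mul_apply]
    symm
    refine Fintype.sum_of_injective e he.injective _ _ ?_ (fun _ => rfl)
    intro i hi
    rw [hz i (e b) ((hC _).2 ⟨b, rfl⟩) (fun h => hi ((hC _).1 h)), mul_zero]
  rw [this, Matrix.det_mul, Matrix.det_of_isUpperTriangular (M := Matrix.of fun a b : Fin r => v (e a) (e b))]
  · simp [h1]
  · intro a b hab
    exact hl _ _ (he hab)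

lemma isPoly_add {n : ℕ} {f g : ↥(SpSet n) → ℂ} (hf : IsPolyFn n f) (hg : IsPolyFn n g) : IsPolyFn n (f + g) := by
  obtain ⟨P, hP⟩ := hf; obtain ⟨Q, hQ⟩ := hg
  exact ⟨P + Q, fun x => by simp [hP, hQ]⟩

lemma isPoly_mul {n : ℕ} {f g : ↥(SpSet n) → ℂ} (hf : IsPolyFn n f) (hg : IsPolyFn n g) : IsPolyFn n (f * g) := by
  obtain ⟨P, hP⟩ := hf; obtain ⟨Q, hQ⟩ := hg
  exact ⟨P * Q, fun x => by simp [hP, hQ]⟩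

/-- the algebra B -/
def BAlg (n : ℕ) : Subalgebra ℂ (↥(SpSet n) → ℂ) where
  carrier := BSet n
  mul_mem' := fun {f g} hf hg => ⟨isPoly_mul hf.1 hg.1, fun u hu v hv x y h => by
    simp [hf.2 u hu v hv x y h, hg.2 u hu v hv x y h]⟩
  add_mem' := fun {f g} hf hg => ⟨isPoly_add hf.1 hg.1, fun u hu v hv x y h => by
    simp [hf.2 u hu v hv x y h, hg.2 u hu v hv x y h]⟩
  algebraMap_mem' := fun r => ⟨⟨MvPolynomial.C r, fun x => by simp⟩, fun u hu v hv x y h => rfl⟩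

def dG (n : ℕ) (c : Lab n) (x : ↥(SpSet n)) : ℂ := dl n c x.1

lemma dG_poly (n : ℕ) (c : Lab n) : IsPolyFn n (dG n c) := by
  refine ⟨Matrix.det (Matrix.of fun i j : Fin (lset n c).card =>
    MvPolynomial.X (Fin.castLE (le_trans (lset n c).card_le_univ (by simp)) i, ((lset n c).orderIsoOfFin rfl j).1)), fun x => ?_⟩
  rw [RingHom.map_det]
  unfold dG dl deltaFn
  congr 1
  ext i j
  simp

lemma dG_mem (n : ℕ) (hn : 2 ≤ n) (c : Lab n) : dG n c ∈ BAlg n := by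
  refine ⟨dG_poly n c, fun u hu v hv x y h => ?_⟩
  unfold dG
  have hu1 : IsUnit u.det := (Matrix.isUnit_iff_isUnit_det _).1 hu.1.1
  have : u * y.1 = x.1 * v := by
    rw [h, Matrix.mul_assoc, Matrix.mul_nonsing_inv_cancel_left _ _ hu1]
  rw [← dl_left n hn c u y.1 hu.2.1 hu.2.2, this, dl_right n hn c v x.1 hv]

end

section
/-! ### Linear independence -/

def cst {n : ℕ} (k : Fin (n-1)) : Fin n := ⟨k, by omega⟩
def csc {n : ℕ} (k : Fin (n-1)) : Fin n := ⟨k+1, by omega⟩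

def Dv {n : ℕ} (ε j j' : Fin n → ℂ) (k : Fin (n-1)) : ℂ :=
  ε (cst k) * j (cst k) * j' (csc k) - j' (cst k) * (ε (csc k) * j (csc k))

def val (n : ℕ) (ε : Fin n → ℂ) (ι : Fin (n-1) → ℂˣ) (j j' : Fin n → ℂ) : Lab n → ℂ
  | .inl (.inl i) => ε i * j i
  | .inl (.inr i) => j' i
  | .inr (.inl k) => ι k
  | .inr (.inr k) => Dv ε j j' k / ι k

def chr {r : ℕ} (m : Fin r → ℤ) : (Fin r → ℂˣ) →* ℂ where
  toFun ι := ∏ k, ((ι k ^ m k : ℂˣ) : ℂ)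
  map_one' := by simp
  map_mul' := by intro a b; simp [mul_zpow, Finset.prod_mul_distrib]

lemma chr_inj (r : ℕ) : Function.Injective (chr (r := r)) := by
  intro m m' h
  ext k
  have h2 : (2:ℂ) ≠ 0 := two_ne_zero
  have := DFunLike.congr_fun h (Pi.mulSingle k (Units.mk0 2 h2))
  simp only [chr, MonoidHom.coe_mk, OneHom.coe_mk] at this
  rw [Finset.prod_eq_single k, Finset.prod_eq_single k] at this
  · simp only [Pi.mulSingle_eq_same, Units.val_zpow_eq_zpow_val, Units.val_mk0] at this
    have h3 : ((2:ℝ):ℂ) ^ m k = ((2:ℝ):ℂ) ^ m' k := by simpa using this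
    rw [← Complex.ofReal_zpow, ← Complex.ofReal_zpow, Complex.ofReal_inj] at h3
    exact zpow_right_injective₀ (by norm_num) (by norm_num) h3
  all_goals intros; simp_all

def mdeg {n : ℕ} (e : Lab n → ℕ) (k : Fin (n-1)) : ℤ := (e (.inr (.inl k)) : ℤ) - e (.inr (.inr k))

lemma val_prod (n : ℕ) (ε : Fin n → ℂ) (ι : Fin (n-1) → ℂˣ) (j j' : Fin n → ℂ) (e : Lab n → ℕ) :
    ∏ c, val n ε ι j j' c ^ e c = chr (mdeg e) ι *
      ((∏ i, (ε i * j i) ^ e (.inl (.inl i))) * (∏ i, j' i ^ e (.inl (.inr i))) *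
        ∏ k, Dv ε j j' k ^ e (.inr (.inr k))) := by
  simp only [Fintype.prod_sum_type, val, chr, MonoidHom.coe_mk, OneHom.coe_mk, mdeg]
  have : ∀ k : Fin (n-1), ((ι k ^ ((e (.inr (.inl k)) : ℤ) - e (.inr (.inr k))) : ℂˣ) : ℂ) =
    (ι k : ℂ) ^ e (.inr (.inl k)) * ((ι k : ℂ) ^ e (.inr (.inr k)))⁻¹ := by
    intro k
    rw [zpow_sub]
    simp
  simp only [this, div_eq_mul_inv, mul_pow, inv_pow, Finset.prod_mul_distrib]
  ring

lemma LI_lemma (n : ℕ) (hn : 2 ≤ n) (s : Finset (Lab n → ℕ)) (hs : ∀ e ∈ s, Good n e) (c : (Lab n → ℕ) → ℂ)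
    (ε : Fin n → ℂ) (hε : ∀ k : Fin (n-1), ε (cst k) ≠ 0 ∨ ε (csc k) ≠ 0)
    (hc : ∀ e ∈ s, c e ≠ 0 → ∀ i, ε i = 0 → e (.inl (.inl i)) = 0)
    (hz : ∀ ι j j', j' ⟨n-1, by omega⟩ ≠ 0 → ∑ e ∈ s, c e * ∏ l, val n ε ι j j' l ^ e l = 0) :
    ∀ e ∈ s, c e = 0 := by
  classical
  intro e₀ he₀
  by_contra hce
  set m := mdeg e₀ with hm
  let sm := s.filter (fun e => mdeg e = m)
  have he0m : e₀ ∈ sm := by simp [sm, hm, he₀]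
  -- step 1
  have step1 : ∀ j j' : Fin n → ℂ, j' ⟨n-1, by omega⟩ ≠ 0 → ∑ e ∈ sm, c e *
      ((∏ i, (ε i * j i) ^ e (.inl (.inl i))) * (∏ i, j' i ^ e (.inl (.inr i))) *
        ∏ k, Dv ε j j' k ^ e (.inr (.inr k))) = 0 := by
    intro j j' hj
    set F : (Lab n → ℕ) → ℂ := fun e => c e *
      ((∏ i, (ε i * j i) ^ e (.inl (.inl i))) * (∏ i, j' i ^ e (.inl (.inr i))) *
        ∏ k, Dv ε j j' k ^ e (.inr (.inr k))) with hF
    have li := (linearIndependent_monoidHom (Fin (n-1) → ℂˣ) ℂ).comp (chr (r := n-1)) (chr_inj _)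
    rw [linearIndependent_iff'] at li
    have := li (s.image mdeg) (fun m' => ∑ e ∈ s.filter (fun e => mdeg e = m'), F e) ?_ m
      (Finset.mem_image_of_mem _ he₀)
    · exact this
    · ext ι
      simp only [Finset.sum_apply, Pi.smul_apply, Function.comp, smul_eq_mul, Pi.zero_apply]
      have h1 : ∀ m' ∈ s.image mdeg, (∑ e ∈ s.filter (fun e => mdeg e = m'), F e) * chr m' ι =
          ∑ e ∈ s.filter (fun e => mdeg e = m'), F e * chr (mdeg e) ι := by
        intro m' _
        rw [Finset.sum_mul]
        refine Finset.sum_congr rfl fun e he => ?_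
        rw [(Finset.mem_filter.1 he).2]
      rw [Finset.sum_congr rfl h1, Finset.sum_fiberwise_of_maps_to (fun e he => Finset.mem_image_of_mem _ he),
        ← hz ι j j' hj]
      refine Finset.sum_congr rfl fun e he => ?_
      rw [val_prod, hF]; ring
  -- polynomials
  let X : Fin n ⊕ Fin n → MvPolynomial (Fin n ⊕ Fin n) ℂ := MvPolynomial.X
  let DP : Fin (n-1) → MvPolynomial (Fin n ⊕ Fin n) ℂ := fun k =>
    MvPolynomial.C (ε (cst k)) * X (.inl (cst k)) * X (.inr (csc k)) -
      X (.inr (cst k)) * (MvPolynomial.C (ε (csc k)) * X (.inl (csc k)))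
  have hDP : ∀ k (j j' : Fin n → ℂ), MvPolynomial.eval (Sum.elim j j') (DP k) = Dv ε j j' k := by
    intro k j j'; simp [DP, X, Dv]
  have hne : ∀ k : Fin (n-1), (cst k : Fin n) ≠ csc k := by
    intro k h; simp [cst, csc] at h
  have hDP0 : ∀ k, DP k ≠ 0 := by
    intro k h0
    rcases hε k with h | h
    · have := hDP k (Pi.single (cst k) 1) (Pi.single (csc k) 1)
      rw [h0] at this
      simp [Dv, (hne k).symm, hne k] at this
      exact h this.symm
    · have := hDP k (Pi.single (csc k) 1) (Pi.single (cst k) 1)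
      rw [h0] at this
      simp [Dv, (hne k).symm, hne k] at this
      exact h this
  let ex : (Lab n → ℕ) → (Fin n ⊕ Fin n →₀ ℕ) := fun e => Finsupp.equivFunOnFinite.symm (fun x => e (.inl x))
  let co : (Lab n → ℕ) → ℂ := fun e => c e * ∏ i, ε i ^ e (.inl (.inl i))
  let P : MvPolynomial (Fin n ⊕ Fin n) ℂ := ∑ e ∈ sm, MvPolynomial.monomial (ex e) (co e)
  have hdet : ∀ e ∈ sm, ∀ k, e (.inr (.inl k)) = e₀ (.inr (.inl k)) ∧ e (.inr (.inr k)) = e₀ (.inr (.inr k)) := by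
    intro e he k
    have h1 := hs e (Finset.mem_filter.1 he).1 k
    have h2 := hs e₀ he₀ k
    have h3 := congrFun (Finset.mem_filter.1 he).2 k
    simp only [hm, mdeg] at h3
    omega
  have hPz : P * (∏ k, DP k ^ e₀ (.inr (.inr k))) * X (.inr ⟨n-1, by omega⟩) = 0 := by
    apply MvPolynomial.funext
    intro x
    obtain ⟨j, j', rfl⟩ : ∃ j j' : Fin n → ℂ, x = Sum.elim j j' := ⟨x ∘ .inl, x ∘ .inr, by simp⟩
    simp only [map_mul, map_prod, map_pow, hDP, map_zero]
    by_cases hj : j' ⟨n-1, by omega⟩ = 0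
    · simp [X, hj]
    · rw [← step1 j j' hj] 
      have : MvPolynomial.eval (Sum.elim j j') P * ∏ k, Dv ε j j' k ^ e₀ (.inr (.inr k)) = 0 := by
        rw [← step1 j j' hj]
        simp only [P, map_sum, Finset.sum_mul]
        refine Finset.sum_congr rfl fun e he => ?_
        rw [MvPolynomial.eval_monomial, Finsupp.prod_fintype _ _ (by simp)]
        simp only [ex, Finsupp.equivFunOnFinite_symm_apply_apply, Fintype.prod_sum_type, Sum.elim_inl, Sum.elim_inr, co,
          mul_pow, Finset.prod_mul_distrib]
        have hk : ∏ k, Dv ε j j' k ^ e (.inr (.inr k)) = ∏ k, Dv ε j j' k ^ e₀ (.inr (.inr k)) :=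
          Finset.prod_congr rfl (fun k _ => by rw [(hdet e he k).2])
        rw [hk]
        ring
      rw [this, zero_mul, step1 j j' hj]
  have hP : P = 0 := by
    rcases mul_eq_zero.1 hPz with h | h
    · rcases mul_eq_zero.1 h with h | h
      · exact h
      · obtain ⟨k, _, hk⟩ := Finset.prod_eq_zero_iff.1 h
        exact absurd hk (pow_ne_zero _ (hDP0 k))
    · exact absurd h (MvPolynomial.X_ne_zero _)
  have hco : MvPolynomial.coeff (ex e₀) P = co e₀ := by
    simp only [P, MvPolynomial.coeff_sum, MvPolynomial.coeff_monomial]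
    rw [Finset.sum_eq_single e₀]
    · simp
    · intro e he hne
      rw [if_neg]
      intro h
      apply hne
      ext x
      rcases x with x | (x | x)
      · have := DFunLike.congr_fun h x
        simpa [ex] using this
      · exact (hdet e he x).1
      · exact (hdet e he x).2
    · intro h
      exact absurd he0m h
  rw [hP] at hco
  simp only [MvPolynomial.coeff_zero, co] at hco
  rcases mul_eq_zero.1 hco.symm with h | h
  · exact hce h
  · obtain ⟨i, _, hi⟩ := Finset.prod_eq_zero_iff.1 h
    by_cases h0 : ε i = 0
    · rw [hc e₀ he₀ hce i h0] at hi; simp at hi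
    · exact pow_ne_zero _ h0 hi

end

section
/-! ### Block coordinates -/

open Matrix

abbrev BMat (n : ℕ) := Matrix (Fin n ⊕ Fin n) (Fin n ⊕ Fin n) ℂ
abbrev NMat (n : ℕ) := Matrix (Fin n) (Fin n) ℂ

def bixF (n : ℕ) : Fin n ⊕ Fin n → Fin (2*n)
  | .inl i => ⟨i, by omega⟩
  | .inr i => ⟨2*n-1-i, by omega⟩

lemma bixF_bij (n : ℕ) : Function.Bijective (bixF n) := by
  rw [Fintype.bijective_iff_injective_and_card]
  constructor
  · rintro (i|i) (j|j) h <;> simp only [bixF, Fin.mk.injEq] at h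
    · rw [Fin.ext h]
    · omega
    · omega
    · have : i = j := by ext; omega
      rw [this]
  · simp; ring

def bix (n : ℕ) : Fin n ⊕ Fin n ≃ Fin (2*n) := Equiv.ofBijective _ (bixF_bij n)

@[simp] lemma bix_inl (n : ℕ) (i : Fin n) : ((bix n (.inl i) : Fin (2*n)) : ℕ) = i := rfl
@[simp] lemma bix_inr (n : ℕ) (i : Fin n) : ((bix n (.inr i) : Fin (2*n)) : ℕ) = 2*n-1-i := rfl

def fromB {n : ℕ} (M : BMat n) : Mat n := M.submatrix (bix n).symm (bix n).symm
def toB {n : ℕ} (M : Mat n) : BMat n := M.submatrix (bix n) (bix n)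

lemma fromB_toB {n : ℕ} (M : Mat n) : fromB (toB M) = M := by
  ext i j; simp [fromB, toB]

lemma toB_fromB {n : ℕ} (M : BMat n) : toB (fromB M) = M := by
  ext i j; simp [fromB, toB]

lemma fromB_mul {n : ℕ} (M N : BMat n) : fromB (M * N) = fromB M * fromB N := by
  simp [fromB, Matrix.submatrix_mul_equiv]

lemma toB_mul {n : ℕ} (M N : Mat n) : toB (M * N) = toB M * toB N := by
  simp [toB, Matrix.submatrix_mul_equiv]

lemma Jmat_app {n : ℕ} (p q : Fin (2*n)) (a b : ℕ) (ha : (p:ℕ) = a) (hb : (q:ℕ) = b) :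
    Jmat n p q = if a + b + 1 = 2*n then (if a < n then 1 else -1) else 0 := by
  subst ha hb; rfl

lemma toB_J (n : ℕ) : toB (Jmat n) = - Matrix.J (Fin n) ℂ := by
  ext i j
  rw [toB, Matrix.submatrix_apply]
  rcases i with i | i <;> rcases j with j | j
  · rw [Jmat_app _ _ i j rfl rfl, if_neg (by omega)]; simp [Matrix.J]
  · rw [Jmat_app _ _ i (2*n-1-j) rfl rfl]
    by_cases h : i = j
    · subst h; rw [if_pos (by omega), if_pos (by omega)]; simp [Matrix.J]
    · rw [if_neg (by rw [Fin.ext_iff] at h; omega)]; simp [Matrix.J, Matrix.one_apply, h]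
  · rw [Jmat_app _ _ (2*n-1-i) j rfl rfl]
    by_cases h : i = j
    · subst h; rw [if_pos (by omega), if_neg (by omega)]; simp [Matrix.J]
    · rw [if_neg (by rw [Fin.ext_iff] at h; omega)]; simp [Matrix.J, Matrix.one_apply, h]
  · rw [Jmat_app _ _ (2*n-1-i) (2*n-1-j) rfl rfl, if_neg (by omega)]; simp [Matrix.J]

lemma toB_transpose {n : ℕ} (M : Mat n) : toB Mᵀ = (toB M)ᵀ := rfl

lemma toB_inj {n : ℕ} {M N : Mat n} (h : toB M = toB N) : M = N := by
  rw [← fromB_toB M, h, fromB_toB]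

abbrev SP (n : ℕ) := Matrix.symplecticGroup (Fin n) ℂ

lemma toB_mem {n : ℕ} (g : Mat n) (hg : g ∈ SpSet n) : toB g ∈ SP n := by
  rw [SymplecticGroup.mem_iff']
  have := congrArg toB hg.2
  rw [toB_mul, toB_mul, toB_J, toB_transpose] at this
  simpa using this

lemma fromB_mem {n : ℕ} (g : BMat n) (hg : g ∈ SP n) : fromB g ∈ SpSet n := by
  constructor
  · have h := SymplecticGroup.symplectic_det hg
    rw [Matrix.isUnit_iff_isUnit_det]
    have : (fromB g).det = g.det := Matrix.det_submatrix_equiv_self _ _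
    rwa [this]
  · apply toB_inj
    rw [toB_mul, toB_mul, toB_J, toB_transpose, toB_fromB]
    simpa using (SymplecticGroup.mem_iff').1 hg

def mkG {n : ℕ} (g : BMat n) (hg : g ∈ SP n) : ↥(SpSet n) := ⟨fromB g, fromB_mem g hg⟩

lemma mkG_toB {n : ℕ} (g : ↥(SpSet n)) : mkG (toB g.1) (toB_mem _ g.2) = g :=
  Subtype.ext (fromB_toB _)

/-- upper unipotent -/
def UU {n : ℕ} (a : NMat n) : Prop := (∀ i j, j < i → a i j = 0) ∧ ∀ i, a i i = 1
/-- trivial last row and column -/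
def Tr {n : ℕ} (a : NMat n) : Prop :=
  ∀ i j : Fin n, ((i:ℕ)+1 = n ∨ (j:ℕ)+1 = n) → a i j = if i = j then 1 else 0

lemma upper_inv {n : ℕ} (a : NMat n) (h0 : ∀ i j, j < i → a i j = 0) (h1 : ∀ i, a i i ≠ 0) :
    IsUnit a.det ∧ (∀ i j, j < i → a⁻¹ i j = 0) ∧ ∀ i, a⁻¹ i i = (a i i)⁻¹ := by
  have ht : a.IsUpperTriangular := fun i j h => h0 i j h
  have hd : IsUnit a.det := by
    rw [Matrix.det_of_isUpperTriangular ht, isUnit_iff_ne_zero, Finset.prod_ne_zero_iff]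
    exact fun i _ => h1 i
  letI := Matrix.invertibleOfIsUnitDet a hd
  have h2 : ∀ i j, j < i → a⁻¹ i j = 0 := fun i j h =>
    Matrix.blockTriangular_inv_of_blockTriangular ht h
  refine ⟨hd, h2, fun i => ?_⟩
  have := congrFun (congrFun (Matrix.mul_nonsing_inv a hd) i) i
  rw [Matrix.mul_apply, Finset.sum_eq_single i, Matrix.one_apply_eq] at this
  · exact eq_inv_of_mul_eq_one_right this
  · intro b _ hb
    rcases lt_or_gt_of_ne hb with h | h
    · rw [h0 i b h, zero_mul]
    · rw [h2 b i h, mul_zero]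
  · simp

lemma UU.det {n : ℕ} {a : NMat n} (h : UU a) : IsUnit a.det :=
  (upper_inv a h.1 (fun i => by rw [h.2]; exact one_ne_zero)).1

lemma UU.inv {n : ℕ} {a : NMat n} (h : UU a) : UU a⁻¹ :=
  ⟨(upper_inv a h.1 (fun i => by rw [h.2]; exact one_ne_zero)).2.1, fun i => by
    rw [(upper_inv a h.1 (fun i => by rw [h.2]; exact one_ne_zero)).2.2, h.2, inv_one]⟩

lemma UU.one {n : ℕ} : UU (1 : NMat n) := ⟨fun i j h => by rw [Matrix.one_apply_ne h.ne'], fun i => by simp⟩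

lemma Tr.inv {n : ℕ} {a : NMat n} (h : Tr a) (hd : IsUnit a.det) : Tr a⁻¹ := by
  intro i j hij
  have : (i:ℕ)+1 = n ∨ (j:ℕ)+1 = n := hij
  rcases hij with hi | hj
  · have := congrFun (congrFun (Matrix.mul_nonsing_inv a hd) i) j
    rw [Matrix.mul_apply, Finset.sum_eq_single i] at this
    · rw [h i i (Or.inl hi), if_pos rfl, one_mul] at this
      rw [this, Matrix.one_apply]
    · intro b _ hb
      rw [h i b (Or.inl hi), if_neg hb.symm, zero_mul]
    · simp
  · have := congrFun (congrFun (Matrix.nonsing_inv_mul a hd) i) j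
    rw [Matrix.mul_apply, Finset.sum_eq_single j] at this
    · rw [h j j (Or.inl hj), if_pos rfl, mul_one] at this
      rw [this, Matrix.one_apply]
    · intro b _ hb
      rw [h b j (Or.inr hj), if_neg hb, mul_zero]
    · simp

lemma inv_block {n : ℕ} {f : ↥(SpSet n) → ℂ} (hf : f ∈ BSet n) (g h : BMat n) (hg : g ∈ SP n) (hh : h ∈ SP n)
    (L Z W a b d : NMat n) (hu : fromBlocks L 0 Z W ∈ SP n) (hv : fromBlocks a b 0 d ∈ SP n)
    (hL : UU Lᵀ) (hW : UU W) (ha : UU a) (hd : UU dᵀ) (ha' : Tr a) (hd' : Tr d)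
    (hb : ∀ i j : Fin n, ((i:ℕ)+1 = n ∨ (j:ℕ)+1 = n) → b i j = 0)
    (e : fromBlocks L 0 Z W * h = g * fromBlocks a b 0 d) : f (mkG h hh) = f (mkG g hg) := by
  have hum : fromB (fromBlocks L 0 Z W) ∈ SpSet n := fromB_mem _ hu
  refine hf.2 (fromB (fromBlocks L 0 Z W)) ⟨hum, ?_, ?_⟩ (fromB (fromBlocks a b 0 d))
    ⟨fromB_mem _ hv, ?_, ?_, ?_⟩ _ _ ?_
  · intro i j hij
    obtain ⟨i, rfl⟩ := (bix n).surjective i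
    obtain ⟨j, rfl⟩ := (bix n).surjective j
    rw [Fin.lt_def] at hij
    rcases i with i | i <;> rcases j with j | j <;> simp only [fromB, submatrix_apply, Equiv.symm_apply_apply,
      fromBlocks_apply₁₁, fromBlocks_apply₁₂, fromBlocks_apply₂₁, fromBlocks_apply₂₂, Matrix.zero_apply]
    · simp only [bix_inl] at hij
      exact hL.1 j i hij
    · simp only [bix_inl, bix_inr] at hij
      omega
    · simp only [bix_inr] at hij
      exact hW.1 i j (by rw [Fin.lt_def]; omega)
  · intro i
    obtain ⟨i, rfl⟩ := (bix n).surjective i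
    rcases i with i | i
    · simpa [fromB] using hL.2 i
    · simpa [fromB] using hW.2 i
  · intro i j hij
    obtain ⟨i, rfl⟩ := (bix n).surjective i
    obtain ⟨j, rfl⟩ := (bix n).surjective j
    rw [Fin.lt_def] at hij
    rcases i with i | i <;> rcases j with j | j <;> simp only [fromB, submatrix_apply, Equiv.symm_apply_apply,
      fromBlocks_apply₁₁, fromBlocks_apply₁₂, fromBlocks_apply₂₁, fromBlocks_apply₂₂, Matrix.zero_apply]
    · simp only [bix_inl] at hij
      exact ha.1 i j hij
    · simp only [bix_inl, bix_inr] at hij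
      omega
    · simp only [bix_inr] at hij
      exact hd.1 j i (by rw [Fin.lt_def]; omega)
  · intro i
    obtain ⟨i, rfl⟩ := (bix n).surjective i
    rcases i with i | i
    · simpa [fromB] using ha.2 i
    · simpa [fromB] using hd.2 i
  · intro i j hij
    obtain ⟨i, rfl⟩ := (bix n).surjective i
    obtain ⟨j, rfl⟩ := (bix n).surjective j
    rcases i with i | i <;> rcases j with j | j <;> simp only [fromB, submatrix_apply, Equiv.symm_apply_apply,
      fromBlocks_apply₁₁, fromBlocks_apply₁₂, fromBlocks_apply₂₁, fromBlocks_apply₂₂, Matrix.zero_apply,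
      EmbeddingLike.apply_eq_iff_eq, Sum.inl.injEq, Sum.inr.injEq, reduceCtorEq, if_false]
    · simp only [bix_inl] at hij
      exact ha' i j (by omega)
    · simp only [bix_inl, bix_inr] at hij
      exact hb i j (by omega)
    · simp only [bix_inr] at hij
      exact hd' i j (by omega)
  · show fromB h = _ * fromB g * _
    have := congrArg fromB e
    rw [fromB_mul, fromB_mul] at this
    rw [Matrix.mul_assoc, ← this, Matrix.nonsing_inv_mul_cancel_left]
    exact (Matrix.isUnit_iff_isUnit_det _).1 hum.1

lemma diag_mem {n : ℕ} (L : NMat n) (hL : IsUnit L.det) : fromBlocks L 0 0 (L⁻¹)ᵀ ∈ SP n := by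
  rw [SymplecticGroup.fromBlocks_mem_iff]
  simp [← Matrix.transpose_mul, Matrix.nonsing_inv_mul L hL]

lemma Tr.one {n : ℕ} : Tr (1 : NMat n) := fun i j _ => by rw [Matrix.one_apply]

lemma Tr.transpose {n : ℕ} {a : NMat n} (h : Tr a) : Tr aᵀ := fun i j hij => by
  rw [Matrix.transpose_apply, h j i hij.symm]
  simp only [eq_comm]

lemma inv_left {n : ℕ} {f : ↥(SpSet n) → ℂ} (hf : f ∈ BSet n) (g : BMat n) (hg : g ∈ SP n) (L : NMat n)
    (hL : UU Lᵀ) (hm : fromBlocks L 0 0 (L⁻¹)ᵀ * g ∈ SP n) : f (mkG (fromBlocks L 0 0 (L⁻¹)ᵀ * g) hm) = f (mkG g hg) := by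
  have hd : IsUnit L.det := by have := hL.det; rwa [det_transpose] at this
  symm
  refine inv_block hf _ _ hm hg L 0 (L⁻¹)ᵀ 1 0 1 (diag_mem L hd) (by rw [fromBlocks_one]; exact one_mem _) hL ?_
    UU.one (by rw [transpose_one]; exact UU.one) Tr.one Tr.one (by simp) (by rw [fromBlocks_one, mul_one])
  rw [Matrix.transpose_nonsing_inv]
  exact hL.inv

lemma inv_right {n : ℕ} {f : ↥(SpSet n) → ℂ} (hf : f ∈ BSet n) (g : BMat n) (hg : g ∈ SP n) (a : NMat n)
    (ha : UU a) (ha' : Tr a) (hm : g * fromBlocks a 0 0 (a⁻¹)ᵀ ∈ SP n) :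
    f (mkG (g * fromBlocks a 0 0 (a⁻¹)ᵀ) hm) = f (mkG g hg) := by
  refine inv_block hf _ _ hg hm 1 0 1 a 0 (a⁻¹)ᵀ (by rw [fromBlocks_one]; exact one_mem _) (diag_mem a ha.det)
    (by rw [transpose_one]; exact UU.one) UU.one
    ha (by rw [transpose_transpose]; exact ha.inv) ha' (ha'.inv ha.det).transpose (by simp) (by rw [fromBlocks_one, one_mul])

/-- symmetric `A⁻¹ B` -/
lemma sp_symm {n : ℕ} (A B C D : NMat n) (hg : fromBlocks A B C D ∈ SP n) (hA : IsUnit A.det) :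
    (A⁻¹ * B)ᵀ = A⁻¹ * B := by
  have h := SymplecticGroup.transpose_mem hg
  rw [fromBlocks_transpose, SymplecticGroup.fromBlocks_mem_iff] at h
  have h1 : A * Bᵀ = B * Aᵀ := by simpa using h.1
  have hAt : IsUnit Aᵀ.det := by rwa [det_transpose]
  rw [transpose_mul, transpose_nonsing_inv]
  calc Bᵀ * (Aᵀ)⁻¹ = A⁻¹ * (A * Bᵀ) * (Aᵀ)⁻¹ := by rw [Matrix.nonsing_inv_mul_cancel_left _ _ hA]
    _ = A⁻¹ * B := by rw [h1, ← Matrix.mul_assoc, Matrix.mul_nonsing_inv_cancel_right _ _ hAt]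

lemma inv_same {n : ℕ} {f : ↥(SpSet n) → ℂ} (hf : f ∈ BSet n) (A B C D B' C' D' : NMat n)
    (hg : fromBlocks A B C D ∈ SP n) (hh : fromBlocks A B' C' D' ∈ SP n) (hA : IsUnit A.det)
    (hl : ∀ i j : Fin n, (j:ℕ) + 1 = n → B i j = B' i j) :
    f (mkG _ hh) = f (mkG _ hg) := by
  set b := A⁻¹ * B' - A⁻¹ * B with hb
  have hbs : bᵀ = b := by
    rw [hb, transpose_sub, sp_symm A B C D hg hA, sp_symm A B' C' D' hh hA]
  have hv : fromBlocks 1 b 0 1 ∈ SP n := by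
    rw [SymplecticGroup.fromBlocks_mem_iff]; simp [hbs]
  have hAb : A * b + B = B' := by
    rw [hb, Matrix.mul_sub, Matrix.mul_nonsing_inv_cancel_left _ _ hA, Matrix.mul_nonsing_inv_cancel_left _ _ hA,
      sub_add_cancel]
  have hb0 : ∀ i j : Fin n, (j:ℕ)+1 = n → b i j = 0 := by
    intro i j hj
    rw [hb, ← Matrix.mul_sub, Matrix.mul_apply]
    refine Finset.sum_eq_zero fun k _ => ?_
    rw [Matrix.sub_apply, hl k j hj, sub_self, mul_zero]
  let hS : SP n := ⟨_, hh⟩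
  let u : BMat n := fromBlocks A B C D * fromBlocks 1 b 0 1 * (hS⁻¹ : SP n).1
  have hum : u ∈ SP n := mul_mem (mul_mem hg hv) (hS⁻¹).2
  have huh : u * fromBlocks A B' C' D' = fromBlocks A B C D * fromBlocks 1 b 0 1 := by
    have : (hS⁻¹ : SP n).1 * hS.1 = 1 := congrArg Subtype.val (inv_mul_cancel hS)
    show _ * hS.1 = _
    rw [Matrix.mul_assoc, this, Matrix.mul_one]
  obtain ⟨Z, W, hu⟩ : ∃ Z W, u = fromBlocks 1 0 Z W := by
    refine ⟨u.toBlocks₂₁, u.toBlocks₂₂, ?_⟩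
    have hi : fromBlocks A B' C' D' * (hS⁻¹ : SP n).1 = 1 := congrArg Subtype.val (mul_inv_cancel hS)
    have h1 : u = fromBlocks A B' (u * fromBlocks A B' C' D').toBlocks₂₁ (u * fromBlocks A B' C' D').toBlocks₂₂ *
        (hS⁻¹ : SP n).1 := by
      have : u * fromBlocks A B' C' D' = fromBlocks A B' (u * fromBlocks A B' C' D').toBlocks₂₁ (u * fromBlocks A B' C' D').toBlocks₂₂ := by
        conv_lhs => rw [← fromBlocks_toBlocks (u * fromBlocks A B' C' D')]
        rw [huh, fromBlocks_multiply]
        simp [hAb]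
      rw [← this, Matrix.mul_assoc, hi, Matrix.mul_one]
    ext i j
    rcases i with i | i
    · have e1 : u (.inl i) j = (1 : BMat n) (.inl i) j := by
        rw [h1, ← hi, Matrix.mul_apply, Matrix.mul_apply]
        refine Finset.sum_congr rfl fun k _ => ?_
        rcases k with k | k <;> simp
      rw [e1]
      rcases j with j | j <;> simp [Matrix.one_apply]
    · rcases j with j | j <;> simp [toBlocks₂₁, toBlocks₂₂]
  have hW : W = 1 := by
    rw [hu, SymplecticGroup.fromBlocks_mem_iff] at hum
    simpa using hum.2.2
  subst hW
  rw [hu] at hum huh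
  exact inv_block hf _ _ hg hh 1 Z 1 1 b 1 hum hv (by rw [transpose_one]; exact UU.one) UU.one UU.one
    (by rw [transpose_one]; exact UU.one) Tr.one Tr.one (fun i j hij => by
      rcases hij with h | h
      · rw [← hbs, transpose_apply]; exact hb0 j i h
      · exact hb0 i j h) huh

/-! ### completion -/

def Smat {n : ℕ} (s : Fin n → ℂ) : NMat n := Matrix.of fun i j =>
  if (j:ℕ)+1 = n then s i else if (i:ℕ)+1 = n then s j else 0

def comp {n : ℕ} (A : NMat n) (b : Fin n → ℂ) : BMat n :=
  fromBlocks A (A * Smat (A⁻¹ *ᵥ b)) 0 (A⁻¹)ᵀ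

lemma Smat_symm {n : ℕ} (s : Fin n → ℂ) : (Smat s)ᵀ = Smat s := by
  ext i j
  simp only [Smat, transpose_apply, Matrix.of_apply]
  split_ifs with h1 h2
  · have : i = j := by ext; omega
    rw [this]
  all_goals rfl

lemma comp_mem {n : ℕ} (A : NMat n) (b : Fin n → ℂ) (hA : IsUnit A.det) : comp A b ∈ SP n := by
  unfold comp
  rw [SymplecticGroup.fromBlocks_mem_iff]
  refine ⟨by simp, ?_, by simp [← Matrix.transpose_mul, Matrix.nonsing_inv_mul A hA]⟩
  rw [transpose_mul, Smat_symm, transpose_transpose, Matrix.mul_assoc, ← Matrix.transpose_mul, Matrix.nonsing_inv_mul A hA,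
    Matrix.nonsing_inv_mul_cancel_left _ _ hA]
  simp

lemma comp_last {n : ℕ} (A : NMat n) (b : Fin n → ℂ) (hA : IsUnit A.det) (i j : Fin n) (hj : (j:ℕ)+1 = n) :
    (A * Smat (A⁻¹ *ᵥ b)) i j = b i := by
  have : (A * Smat (A⁻¹ *ᵥ b)) i j = (A *ᵥ (A⁻¹ *ᵥ b)) i := by
    rw [Matrix.mul_apply]
    simp [Matrix.mulVec, dotProduct, Smat, hj]
  rw [this, mulVec_mulVec, Matrix.mul_nonsing_inv A hA, one_mulVec]

end

section
/-! ### Polynomial paths in the symplectic group -/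

open Matrix

/- adapted from Mathlib's proof that symplectic matrices have determinant one -/
lemma exists_symm_X {l : Type} [Fintype l] [DecidableEq l] {R : Type*} [Field R]
    {A C : Matrix l l R} (hker : ∀ (x : l → R), (A • x = 0) → (C • x = 0) → x = 0)
    (hsymm : Aᵀ * C = Cᵀ * A) :
    ∃ (X : Matrix l l R), X.IsSymm ∧ IsUnit (A + X * C) := by
  -- `C` is transformed into `P = fromBlocks 1 0 0 0` by invertible matrices `V` and `U`.
  rcases exists_rank_normal_form C with ⟨V, U, s, hV, hU, heq⟩
  set P := V * C * U with P_def; set Q := Vᵀ⁻¹ * A * U with Q_def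
  set f := fun (x : Matrix l l R) ↦ x.submatrix s.symm s.symm
  have hf (x) : f x = x.submatrix s.symm s.symm := rfl
  have f_unit {x} : IsUnit x → IsUnit (f x) := (isUnit_submatrix_equiv ..).2
  have f_mul (x y) : f (x * y) = f x * f y := submatrix_mul _ _ _ _ _ s.symm.bijective
  have _ : Invertible V := hV.invertible
  have _ : Invertible U := hU.invertible
  have _ : Invertible (f Vᵀ) := (f_unit (V.isUnit_transpose.2 hV)).invertible
  -- The hypothesis that the only vector annihilated by both matrices is 0, holds for `P` and `Q`.
  have con1 (x : Fin C.rank ⊕ Fin (Fintype.card l - C.rank) → R)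
      (heq1 : (f Q) • x = 0) (heq2 : (f P) • x = 0) : x = 0 := by
    refine (f_unit hU).smul_left_cancel.1 ?_
    rw [f_mul, f_mul, mul_assoc, mul_smul, IsUnit.smul_eq_zero, mul_smul, hf,
      smul_eq_mulVec, submatrix_mulVec_equiv, Equiv.symm_symm] at heq1 heq2
    · rw [Equiv.comp_symm_eq, Pi.zero_comp] at heq1 heq2
      exact s.surjective.injective_comp_right <| by simpa using hker _ heq1 heq2
    · exact f_unit hV
    · exact f_unit <| isUnit_nonsing_inv_iff.2 <| V.isUnit_transpose.2 hV
  -- The symmetry relation also holds for `P` and `Q`.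
  have con2 : Qᵀ * P = Pᵀ * Q := by
    simp only [P_def, mul_assoc, transpose_mul, transpose_nonsing_inv, transpose_transpose, Q_def,
      inv_mul_cancel_left_of_invertible, mul_inv_cancel_left_of_invertible]
    rw [← mul_assoc Aᵀ, hsymm, mul_assoc]
  replace con2 : (f Q).toBlocks₁₁ᵀ = (f Q).toBlocks₁₁ ∧ (f Q).toBlocks₁₂ = 0 := by
    apply_fun reindex s s at con2
    rw [reindex_apply, reindex_apply, ← hf, ← hf, f_mul, f_mul Pᵀ, heq, hf,
      ← transpose_submatrix, ← hf Q, ← (f Q).fromBlocks_toBlocks, hf (_)ᵀ, hf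
      ((fromBlocks 1 0 0 0).submatrix _ _)] at con2
    simp [fromBlocks_transpose, fromBlocks_multiply] at con2; tauto
  -- The lower-right block of `Q` is invertible.
  have con3 : IsUnit (f Q).toBlocks₂₂ := by
    refine mulVec_injective_iff_isUnit.1 ?_
    rw [← coe_mulVecLin, ← LinearMap.ker_eq_bot]
    refine ker_mulVecLin_eq_bot_iff.2 fun x hx ↦ Sum.elim_injective' <|
      (con1 _ ?_ ?_).trans Sum.elim_zero_zero.symm
    · rw [← (f Q).fromBlocks_toBlocks]; simp [hx, con2.2, fromBlocks_mulVec]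
    · simp [hf, heq, fromBlocks_mulVec]
  set Y : Matrix (Fin C.rank ⊕ Fin (Fintype.card l - C.rank)) (Fin C.rank ⊕
    Fin (Fintype.card l - C.rank)) R := fromBlocks (1 - (f Q).toBlocks₁₁) 0 0 0 with Y_def
  have hY_symm : Y.IsSymm := by
    rw [Y_def, isSymm_fromBlocks_iff]
    exact ⟨IsSymm.sub isSymm_one con2.1, by simp⟩
  -- We now take `X = Vᵀ * Y * V` and this gives the desired matrix `X.submatrix s s`.
  set X := (f Vᵀ) * Y * (f V) with X_def
  refine ⟨X.submatrix s s, IsSymm.submatrix ?_ s, (isUnit_submatrix_equiv s.symm s.symm).1 ?_⟩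
  · simp_rw [X_def, Matrix.IsSymm, transpose_mul, hY_symm.eq, hf, transpose_submatrix,
      transpose_transpose, mul_assoc]
  · have heq' : f (A + X.submatrix s s * C) = (f Vᵀ) * (f Q + Y * (f P)) * f (U⁻¹) := by
      simp_rw [hf, submatrix_add, Pi.add_apply, Q_def, P_def, ← hf, f_mul, hf, mul_add, ← mul_assoc,
        ← inv_submatrix_equiv, add_mul, mul_assoc _ (U.submatrix _ _), mul_inv_of_invertible]
      simp [X_def]; rfl
    rw [← hf, heq', IsUnit.mul_iff, IsUnit.mul_iff]
    refine ⟨⟨isUnit_of_invertible _, ?_⟩, ?_⟩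
    · nth_rw 1 [Y_def, heq, ← (f Q).fromBlocks_toBlocks, con2.2]
      simpa [hf, fromBlocks_multiply, fromBlocks_add]
    · exact f_unit <| isUnit_nonsing_inv_iff.2 hU

lemma exists_X {n : ℕ} {A B C D : NMat n} (hA : fromBlocks A B C D ∈ SP n) :
    ∃ X : NMat n, Xᵀ = X ∧ IsUnit (A + X * C).det := by
  have hF : IsUnit (fromBlocks A B C D) :=
    (isUnit_iff_isUnit_det _).2 (SymplecticGroup.symplectic_det hA)
  have hker (x : Fin n → ℂ) (hx1 : A *ᵥ x = 0) (hx2 : C *ᵥ x = 0) : x = 0 := by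
    have hv0 : fromBlocks A B C D *ᵥ (Sum.elim x 0) = fromBlocks A B C D *ᵥ (Sum.elim 0 0) := by
      simp [fromBlocks_mulVec, hx1, hx2]
    exact (Sum.elim_eq_iff.1 (mulVec_injective_iff_isUnit.2 hF hv0)).1
  obtain ⟨X, h1, h2⟩ := exists_symm_X hker (SymplecticGroup.fromBlocks_mem_iff.1 hA).1
  exact ⟨X, h1, (isUnit_iff_isUnit_det _).1 h2⟩

/-- polynomial functions of one variable -/
def PF : Subalgebra ℂ (ℂ → ℂ) := (Polynomial.aeval (R := ℂ) (id : ℂ → ℂ)).range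

lemma mem_PF (f : ℂ → ℂ) : f ∈ PF ↔ ∃ p : Polynomial ℂ, ∀ s, f s = p.eval s := by
  have key : ∀ (p : Polynomial ℂ) (s : ℂ), (Polynomial.aeval (R := ℂ) (id : ℂ → ℂ)) p s = p.eval s := by
    intro p s
    have := Polynomial.aeval_algHom_apply (Pi.evalAlgHom ℂ (fun _ : ℂ => ℂ) s) (id : ℂ → ℂ) p
    simpa [Polynomial.coe_aeval_eq_eval] using this.symm
  constructor
  · rintro ⟨p, rfl⟩
    exact ⟨p, fun s => key p s⟩
  · rintro ⟨p, hp⟩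
    exact ⟨p, funext fun s => by rw [hp]; exact key p s⟩

lemma PF_const (c : ℂ) : (fun _ => c) ∈ PF := PF.algebraMap_mem c

lemma PF_id : (fun s => s) ∈ PF := (mem_PF _).2 ⟨Polynomial.X, by simp⟩

lemma PF_zero_or {f g : ℂ → ℂ} (hf : f ∈ PF) (hg : g ∈ PF) (h : ∀ s, f s * g s = 0) :
    (∀ s, f s = 0) ∨ (∀ s, g s = 0) := by
  obtain ⟨p, hp⟩ := (mem_PF _).1 hf
  obtain ⟨q, hq⟩ := (mem_PF _).1 hg
  have : p * q = 0 := Polynomial.funext fun s => by simpa [← hp, ← hq] using h s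
  rcases mul_eq_zero.1 this with h | h
  · left; intro s; rw [hp, h]; simp
  · right; intro s; rw [hq, h]; simp

lemma PF_mv {σ : Type} (F : ℂ → σ → ℂ) (hF : ∀ r, (fun s => F s r) ∈ PF) (P : MvPolynomial σ ℂ) :
    (fun s => MvPolynomial.eval (F s) P) ∈ PF := by
  induction P using MvPolynomial.induction_on with
  | C a => simpa using PF_const a
  | add p q hp hq => simp only [map_add]; exact PF.add_mem hp hq
  | mul_X p i hp => simp only [map_mul, MvPolynomial.eval_X]; exact PF.mul_mem hp (hF i)

/-- matrices connected to the identity by a polynomial path -/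
def Pth (n : ℕ) (g : BMat n) : Prop :=
  ∃ H : ℂ → BMat n, H 0 = 1 ∧ H 1 = g ∧ (∀ s, H s ∈ SP n) ∧ ∀ i j, (fun s => H s i j) ∈ PF

lemma Pth.mul {n : ℕ} {g h : BMat n} (hg : Pth n g) (hh : Pth n h) : Pth n (g * h) := by
  obtain ⟨H, h0, h1, h2, h3⟩ := hg
  obtain ⟨K, k0, k1, k2, k3⟩ := hh
  refine ⟨fun s => H s * K s, by simp [h0, k0], by simp [h1, k1], fun s => mul_mem (h2 s) (k2 s), fun i j => ?_⟩
  have : (fun s => (H s * K s) i j) = ∑ k, (fun s => H s i k) * (fun s => K s k j) := by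
    ext s; simp [Matrix.mul_apply]
  rw [this]
  exact sum_mem fun k _ => mul_mem (h3 i k) (k3 k j)

lemma Pth.blocks {n : ℕ} (A B C D : ℂ → NMat n) (h0 : fromBlocks (A 0) (B 0) (C 0) (D 0) = 1)
    (hm : ∀ s, fromBlocks (A s) (B s) (C s) (D s) ∈ SP n)
    (hA : ∀ i j, (fun s => A s i j) ∈ PF) (hB : ∀ i j, (fun s => B s i j) ∈ PF)
    (hC : ∀ i j, (fun s => C s i j) ∈ PF) (hD : ∀ i j, (fun s => D s i j) ∈ PF) :
    Pth n (fromBlocks (A 1) (B 1) (C 1) (D 1)) := by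
  refine ⟨fun s => fromBlocks (A s) (B s) (C s) (D s), h0, rfl, hm, ?_⟩
  rintro (i|i) (j|j)
  · exact hA i j
  · exact hB i j
  · exact hC i j
  · exact hD i j

lemma PF_lin (a b : ℂ) : (fun s => a + s * b) ∈ PF := PF.add_mem (PF_const a) (PF.mul_mem PF_id (PF_const b))

lemma Pth.up {n : ℕ} (X : NMat n) (hX : Xᵀ = X) : Pth n (fromBlocks 1 X 0 1) := by
  have := Pth.blocks (n := n) (fun _ => 1) (fun s => s • X) (fun _ => 0) (fun _ => 1) (by simp)
    (fun s => by rw [SymplecticGroup.fromBlocks_mem_iff]; simp [hX]) (fun i j => PF_const _)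
    (fun i j => by simpa using PF_lin 0 (X i j)) (fun i j => PF_const _) (fun i j => PF_const _)
  simpa using this

lemma Pth.lo {n : ℕ} (X : NMat n) (hX : Xᵀ = X) : Pth n (fromBlocks 1 0 X 1) := by
  have := Pth.blocks (n := n) (fun _ => 1) (fun _ => 0) (fun s => s • X) (fun _ => 1) (by simp)
    (fun s => by rw [SymplecticGroup.fromBlocks_mem_iff]; simp [hX]) (fun i j => PF_const _)
    (fun i j => PF_const _) (fun i j => by simpa using PF_lin 0 (X i j)) (fun i j => PF_const _)
  simpa using this

lemma Pth.w {n : ℕ} (X : NMat n) (hX : Xᵀ = X) (hd : IsUnit X.det) : Pth n (fromBlocks 0 X (-X⁻¹) 0) := by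
  have := ((Pth.up X hX).mul (Pth.lo (-X⁻¹) (by rw [transpose_neg, transpose_nonsing_inv, hX]))).mul (Pth.up X hX)
  simpa [fromBlocks_multiply, Matrix.mul_nonsing_inv X hd, Matrix.nonsing_inv_mul X hd] using this

lemma Pth.sym {n : ℕ} (X : NMat n) (hX : Xᵀ = X) (hd : IsUnit X.det) : Pth n (fromBlocks X 0 0 (X⁻¹)ᵀ) := by
  have h1 : IsUnit (-1 : NMat n).det := (isUnit_iff_isUnit_det _).1 isUnit_one.neg
  have hi : (-1 : NMat n)⁻¹ = -1 := Matrix.inv_eq_right_inv (by simp)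
  have := (Pth.w X hX hd).mul (Pth.w (-1) (by simp) h1)
  rw [transpose_nonsing_inv, hX]
  simpa [fromBlocks_multiply, hi] using this

lemma Pth.gl {n : ℕ} (A : NMat n) (hd : IsUnit A.det) : Pth n (fromBlocks A 0 0 (A⁻¹)ᵀ) := by
  refine Matrix.diagonal_transvection_induction_of_det_ne_zero (fun A => Pth n (fromBlocks A 0 0 (A⁻¹)ᵀ)) A hd.ne_zero ?_ ?_ ?_
  · intro D hD
    exact Pth.sym _ (by simp) (isUnit_iff_ne_zero.2 hD)
  · rintro ⟨i, j, hij, c⟩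
    have hinv : ∀ s : ℂ, (transvection i j (s * c))⁻¹ = transvection i j (-(s*c)) := fun s =>
      Matrix.inv_eq_right_inv (by rw [transvection_mul_transvection_same _ _ hij]; simp)
    have h := Pth.blocks (n := n) (fun s => transvection i j (s*c)) (fun _ => 0) (fun _ => 0)
      (fun s => (transvection i j (-(s*c)))ᵀ) (by simp)
      (fun s => by
        rw [← hinv]; exact diag_mem _ (by rw [det_transvection_of_ne _ _ hij]; exact isUnit_one)) ?_ (fun i j => PF_const _)
      (fun i j => PF_const _) ?_
    · simp only [TransvectionStruct.toMatrix]
      have h2 := hinv 1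
      simp only [one_mul] at h2 h
      rw [h2]
      exact h
    · intro a b
      have := PF_lin ((1 : NMat n) a b) ((single i j c : NMat n) a b)
      convert this using 2 with s
      simp [transvection, single_apply]
    · intro a b
      have := PF_lin ((1 : NMat n) b a) (-(single i j c : NMat n) b a)
      convert this using 2 with s
      by_cases h : i = b ∧ j = a
      · simp [transvection, single_apply, h]
      · simp [transvection, single_apply, h]
  · intro A B hA hB h1 h2
    have := h1.mul h2
    rw [Matrix.mul_inv_rev, transpose_mul]
    simpa [fromBlocks_multiply] using this

lemma Pth.all {n : ℕ} (g : BMat n) (hg : g ∈ SP n) : Pth n g := by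
  rw [← fromBlocks_toBlocks g] at hg ⊢
  generalize g.toBlocks₁₁ = A at *
  generalize g.toBlocks₁₂ = B at *
  generalize g.toBlocks₂₁ = C at *
  generalize g.toBlocks₂₂ = D at *
  obtain ⟨X, hX, hd⟩ := exists_X hg
  have hu : fromBlocks 1 X 0 1 ∈ SP n := by
    rw [SymplecticGroup.fromBlocks_mem_iff]; simp [hX]
  have hm : fromBlocks (A + X * C) (B + X * D) C D ∈ SP n := by
    have := mul_mem hu hg
    simpa [fromBlocks_multiply] using this
  have hP : Pth n (fromBlocks (A + X * C) (B + X * D) C D) := by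
    generalize A + X * C = A' at *
    generalize B + X * D = B' at *
    have hAB := sp_symm A' B' C D hm hd
    have hm' := SymplecticGroup.fromBlocks_mem_iff.1 hm
    have hdt : IsUnit A'ᵀ.det := by rwa [det_transpose]
    have hZ : (C * A'⁻¹)ᵀ = C * A'⁻¹ := by
      rw [transpose_mul, transpose_nonsing_inv]
      calc (A'ᵀ)⁻¹ * Cᵀ = (A'ᵀ)⁻¹ * (Cᵀ * A') * A'⁻¹ := by
            rw [Matrix.mul_assoc, Matrix.mul_assoc, Matrix.mul_nonsing_inv _ hd, Matrix.mul_one]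
        _ = C * A'⁻¹ := by rw [← hm'.1, Matrix.nonsing_inv_mul_cancel_left _ _ hdt]
    have := ((Pth.lo (C * A'⁻¹) hZ).mul (Pth.gl A' hd)).mul (Pth.up (A'⁻¹ * B') hAB)
    convert this using 1
    simp only [fromBlocks_multiply, Matrix.one_mul, Matrix.mul_one, Matrix.mul_zero, Matrix.zero_mul, add_zero, zero_add]
    rw [Matrix.mul_nonsing_inv_cancel_left _ _ hd, Matrix.nonsing_inv_mul_cancel_right _ _ hd]
    congr 1
    have h3 : A'ᵀ * D = 1 + Cᵀ * B' := by rw [← hm'.2.2]; abel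
    calc D = (A'ᵀ)⁻¹ * (A'ᵀ * D) := by rw [Matrix.nonsing_inv_mul_cancel_left _ _ hdt]
      _ = _ := by
        rw [h3, Matrix.mul_add, Matrix.mul_one, add_comm, transpose_nonsing_inv, ← Matrix.mul_assoc (A'ᵀ)⁻¹,
          ← transpose_nonsing_inv, ← transpose_mul, hZ, Matrix.mul_assoc]
  have := (Pth.up (-X) (by rw [transpose_neg, hX])).mul hP
  simpa [fromBlocks_multiply] using this

lemma density {n : ℕ} (φ ψ : ↥(SpSet n) → ℂ) (hφ : IsPolyFn n φ) (hψ : IsPolyFn n ψ) (h0 : BMat n) (hh0 : h0 ∈ SP n)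
    (hne : ψ (mkG h0 hh0) ≠ 0) (h : ∀ x, φ x * ψ x = 0) (x : ↥(SpSet n)) : φ x = 0 := by
  obtain ⟨P, hP⟩ := hφ
  obtain ⟨Q, hQ⟩ := hψ
  let k0 : SP n := ⟨h0, hh0⟩
  let g : SP n := ⟨toB x.1, toB_mem _ x.2⟩
  obtain ⟨H, e0, e1, e2, e3⟩ := Pth.all (g * k0⁻¹).1 (g * k0⁻¹).2
  let F : ℂ → BMat n := fun s => H s * h0
  have hF : ∀ s, F s ∈ SP n := fun s => mul_mem (e2 s) hh0
  have hF0 : F 0 = h0 := by simp [F, e0]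
  have hF1 : F 1 = toB x.1 := by
    show H 1 * k0.1 = g.1
    rw [e1]
    exact congrArg Subtype.val (inv_mul_cancel_right g k0)
  have hFP : ∀ rc : Fin (2*n) × Fin (2*n), (fun s => fromB (F s) rc.1 rc.2) ∈ PF := by
    intro rc
    have : (fun s => fromB (F s) rc.1 rc.2) =
        ∑ k, (fun s => H s ((bix n).symm rc.1) k) * (fun _ => h0 k ((bix n).symm rc.2)) := by
      ext s; simp [F, fromB, Matrix.mul_apply]
    rw [this]
    exact sum_mem fun k _ => mul_mem (e3 _ _) (PF_const _)
  rcases PF_zero_or (PF_mv (fun s rc => fromB (F s) rc.1 rc.2) hFP P) (PF_mv (fun s rc => fromB (F s) rc.1 rc.2) hFP Q)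
    (fun s => by
      have := h (mkG (F s) (hF s))
      rw [hP, hQ] at this
      exact this) with h' | h'
  · have := h' 1
    rw [hF1, fromB_toB] at this
    rw [hP]; exact this
  · exfalso
    have := h' 0
    rw [hF0] at this
    rw [hQ] at hne
    exact hne this

end

section
/-! ### Minors in block coordinates, special points -/

open Matrix

lemma mJ_congr {x x' : ℕ → ℕ → ℂ} {i : ℕ} {v v' : ℕ → ℂ} (hx : ∀ b < i, ∀ a ≤ i, x b a = x' b a)
    (hv : ∀ a ≤ i, v a = v' a) : mJ x i v = mJ x' i v' := by
  unfold mJ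
  congr 1
  ext a b
  simp only [Matrix.of_apply]
  split_ifs with h
  · exact hx b h a (by omega)
  · exact hv a (by omega)

lemma col_ll {n : ℕ} (M : BMat n) (a b : ℕ) (ha : a < n) (hb : b < n) :
    col (fromB M) b a = M (.inl ⟨a, ha⟩) (.inl ⟨b, hb⟩) := by
  unfold col
  rw [dif_pos ⟨by omega, by omega⟩]
  have h1 : (⟨a, by omega⟩ : Fin (2*n)) = bix n (.inl ⟨a, ha⟩) := rfl
  have h2 : (⟨b, by omega⟩ : Fin (2*n)) = bix n (.inl ⟨b, hb⟩) := rfl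
  rw [h1, h2, fromB, submatrix_apply, Equiv.symm_apply_apply, Equiv.symm_apply_apply]

lemma col_lr {n : ℕ} (M : BMat n) (a : ℕ) (ha : a < n) :
    col (fromB M) n a = M (.inl ⟨a, ha⟩) (.inr ⟨n-1, by omega⟩) := by
  unfold col
  rw [dif_pos ⟨by omega, by omega⟩]
  have h1 : (⟨a, by omega⟩ : Fin (2*n)) = bix n (.inl ⟨a, ha⟩) := rfl
  have h2 : (⟨n, by omega⟩ : Fin (2*n)) = bix n (.inr ⟨n-1, by omega⟩) := by
    ext; simp; omega
  rw [h1, h2, fromB, submatrix_apply, Equiv.symm_apply_apply, Equiv.symm_apply_apply]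

/-- a point with prescribed data -/
lemma point (n : ℕ) (hn : 2 ≤ n) (P : ℕ → ℂ) (P0 : P 0 = 1) (hP : ∀ i, P i ≠ 0) (y z : Fin n → ℂ)
    (hz : z ⟨n-1, by omega⟩ ≠ 0) : ∃ (g : BMat n) (hg : g ∈ SP n),
      (∀ i : Fin n, dG n (.inl (.inl i)) (mkG g hg) = P i * y i) ∧
      (∀ i : Fin n, dG n (.inl (.inr i)) (mkG g hg) = P i * z i) ∧
      (∀ k : Fin (n-1), dG n (.inr (.inl k)) (mkG g hg) = P (k+1)) := by
  set t : ℕ → ℂ := fun b => P (b+1) / P b with ht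
  have hprod : ∀ i, ∏ b ∈ Finset.range i, t b = P i := by
    intro i
    induction i with
    | zero => simp [P0]
    | succ i ih => rw [Finset.prod_range_succ, ih, ht]; simp only; rw [mul_div_cancel₀ _ (hP i)]
  let l : Fin n := ⟨n-1, by omega⟩
  let A : NMat n := Matrix.of fun i b => if b = l then z i else if i = b then t b else 0
  have hA : IsUnit A.det := by
    refine (upper_inv A ?_ ?_).1
    · intro i j hij
      have h1 : j ≠ l := by
        intro h; rw [h, Fin.lt_def] at hij; simp only [l] at hij; omega
      simp [A, h1, hij.ne']
    · intro i
      by_cases h : i = l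
      · subst h; simpa [A] using hz
      · simpa [A, h, ht] using ⟨hP _, hP _⟩
  let d : Fin n → ℂ := fun i => if i = l then 1 else 0
  let w : BMat n := fromBlocks (diagonal (fun i => 1 - d i)) (diagonal d) (diagonal (fun i => - d i)) (diagonal (fun i => 1 - d i))
  have hw : w ∈ SP n := by
    rw [SymplecticGroup.fromBlocks_mem_iff]
    simp only [diagonal_transpose, diagonal_mul_diagonal, diagonal_sub]
    refine ⟨by congr 1; ext i; ring, by congr 1; ext i; ring, ?_⟩
    rw [← diagonal_one]
    congr 1; ext i; by_cases h : i = l <;> simp [d, h]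
  let g : BMat n := comp A (fun i => - y i) * w
  have hg : g ∈ SP n := mul_mem (comp_mem A _ hA) hw
  have hgl : ∀ i b : Fin n, g (.inl i) (.inl b) = if b = l then y i else if i = b then t b else 0 := by
    intro i b
    have : g (.inl i) (.inl b) = A i b * (1 - d b) + (A * Smat (A⁻¹ *ᵥ (fun i => - y i))) i b * (- d b) := by
      simp only [g, w, comp, fromBlocks_multiply, fromBlocks_apply₁₁, Matrix.add_apply, mul_diagonal]
    rw [this]
    by_cases h : b = l
    · subst h
      rw [comp_last A _ hA i l (by simp only [l]; omega)]
      simp [d]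
    · simp [d, h, A]
  have hgr : ∀ i, g (.inl i) (.inr l) = z i := by
    intro i
    have : g (.inl i) (.inr l) = A i l * (d l) + (A * Smat (A⁻¹ *ᵥ (fun i => - y i))) i l * (1 - d l) := by
      simp only [g, w, comp, fromBlocks_multiply, fromBlocks_apply₁₂, Matrix.add_apply, mul_diagonal]
    rw [this]
    simp [d, A]
  have hcol : ∀ b < n-1, ∀ a < n, col (fromB g) b a = if a = b then t b else 0 := by
    intro b hb a ha
    rw [col_ll g a b ha (by omega), hgl, if_neg (by simp only [l, Fin.mk.injEq]; omega)]
    simp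
  have hJ : ∀ (i : ℕ) (hi : i < n) (v : ℕ → ℂ), mJ (col (fromB g)) i v = P i * v i := by
    intro i hi v
    rw [mJ_congr (x' := fun b a => if a = b then t b else 0) (v' := v)
      (fun b hb a ha => hcol b (by omega) a (by omega)) (fun _ _ => rfl), mJ_diag _ i v t (fun _ _ _ => rfl), hprod]
  refine ⟨g, hg, fun i => ?_, fun i => ?_, fun k => ?_⟩
  · show deltaFn n (Jset n i) (fromB g) = _
    rw [delta_J n i i.2, hJ i i.2, col_ll g i (n-1) i.2 (by omega), hgl, if_pos rfl]
  · show deltaFn n (JPset n i) (fromB g) = _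
    rw [delta_JP n i i.2, hJ i i.2, col_lr g i i.2, hgr]
  · show deltaFn n (Iset n (k+1)) (fromB g) = _
    have hk := k.2
    rw [delta_I n k k.2, hJ k (by omega), hcol k k.2 k (by omega), if_pos rfl, ht]
    simp only
    rw [mul_div_cancel₀ _ (hP k)]

lemma dG_rel (n : ℕ) (k : Fin (n-1)) (x : ↥(SpSet n)) :
    dG n (.inr (.inl k)) x * dG n (.inr (.inr k)) x =
      dG n (.inl (.inl (cst k))) x * dG n (.inl (.inr (csc k))) x -
      dG n (.inl (.inr (cst k))) x * dG n (.inl (.inl (csc k))) x :=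
  delta_rel n k k.2 x.1

lemma point_val (n : ℕ) (hn : 2 ≤ n) (ε : Fin n → ℂ) (ι : Fin (n-1) → ℂˣ) (j j' : Fin n → ℂ)
    (hz : j' ⟨n-1, by omega⟩ ≠ 0) : ∃ (g : BMat n) (hg : g ∈ SP n), ∀ c, dG n c (mkG g hg) = val n ε ι j j' c := by
  let P : ℕ → ℂ := fun i => if h : 0 < i ∧ i < n then ι ⟨i-1, by omega⟩ else 1
  have hP : ∀ i, P i ≠ 0 := by
    intro i; simp only [P]; split_ifs <;> simp
  obtain ⟨g, hg, h1, h2, h3⟩ := point n hn P (by simp [P]) hP (fun i => ε i * j i / P i) (fun i => j' i / P i)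
    (div_ne_zero hz (hP _))
  have h3' : ∀ k : Fin (n-1), dG n (.inr (.inl k)) (mkG g hg) = ι k := by
    intro k
    have := k.2
    rw [h3, show P (k+1) = ι ⟨k+1-1, by omega⟩ from dif_pos ⟨by omega, by omega⟩]
    simp
  have h1' : ∀ i, dG n (.inl (.inl i)) (mkG g hg) = ε i * j i := fun i => by rw [h1, mul_div_cancel₀ _ (hP _)]
  have h2' : ∀ i, dG n (.inl (.inr i)) (mkG g hg) = j' i := fun i => by rw [h2, mul_div_cancel₀ _ (hP _)]
  refine ⟨g, hg, ?_⟩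
  rintro ((i | i) | (k | k))
  · exact h1' i
  · exact h2' i
  · exact h3' k
  · have := dG_rel n k (mkG g hg)
    rw [h3', h1', h1', h2', h2'] at this
    show _ = Dv ε j j' k / ι k
    rw [eq_div_iff (ι k).ne_zero, mul_comm, this, Dv]

/-- arrow shaped matrices -/
def arrow (n : ℕ) (t w : ℕ → ℂ) : NMat n := Matrix.of fun a b =>
  if (a:ℕ) = 0 then (if (b:ℕ) + 1 = n then t 0 else w b) else if (a:ℕ) = b + 1 then t a else 0

lemma arrow_unit (n : ℕ) (hn : 2 ≤ n) (t w : ℕ → ℂ) (ht : ∀ i < n, t i ≠ 0) : IsUnit (arrow n t w).det := by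
  rw [← isUnit_iff_isUnit_det, ← mulVec_injective_iff_isUnit, ← coe_mulVecLin, ← LinearMap.ker_eq_bot]
  refine ker_mulVecLin_eq_bot_iff.2 fun v hv => ?_
  have h1 : ∀ b : Fin n, (b:ℕ) + 1 < n → v b = 0 := by
    intro b hb
    have := congrFun hv ⟨b+1, hb⟩
    rw [mulVec, dotProduct, Finset.sum_eq_single b] at this
    · simpa [arrow, ht _ hb] using this
    · intro c _ hc
      have : (b:ℕ) ≠ c := fun h => hc (Fin.ext h.symm)
      simp [arrow, this]
    · simp
  have h2 : v ⟨n-1, by omega⟩ = 0 := by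
    have := congrFun hv ⟨0, by omega⟩
    rw [mulVec, dotProduct, Finset.sum_eq_single ⟨n-1, by omega⟩] at this
    · have e : n - 1 + 1 = n := by omega
      simpa [arrow, ht 0 (by omega), e] using this
    · intro c _ hc
      have : (c:ℕ) ≠ n - 1 := fun h => hc (Fin.ext h)
      rw [h1 c (by omega), mul_zero]
    · simp
  ext b
  by_cases h : (b:ℕ) + 1 < n
  · exact h1 b h
  · have : b = ⟨n-1, by omega⟩ := by ext; simp; omega
    rw [this]; exact h2

lemma mK_congr {x x' : ℕ → ℕ → ℂ} {i : ℕ} {u u' v v' : ℕ → ℂ} (hx : ∀ b < i, ∀ a ≤ i+1, x b a = x' b a)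
    (hu : ∀ a ≤ i+1, u a = u' a) (hv : ∀ a ≤ i+1, v a = v' a) : mK x i u v = mK x' i u' v' := by
  unfold mK
  congr 1
  ext a b
  simp only [Matrix.of_apply]
  split_ifs with h
  · exact hx b h a (by omega)
  · exact hu a (by omega)
  · exact hv a (by omega)

lemma arrow_vals (n : ℕ) (hn : 2 ≤ n) (t w : ℕ → ℂ) (ht : ∀ i < n, t i ≠ 0) (c : Fin n → ℂ)
    (hg : comp (arrow n t w) c ∈ SP n) :
    (∀ i : Fin n, dG n (.inl (.inl i)) (mkG _ hg) = (-1)^(i:ℕ) * t 0 * ∏ b ∈ Finset.range i, t (b+1)) ∧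
    (∀ k : Fin (n-1), dG n (.inr (.inl k)) (mkG _ hg) = (-1)^(k:ℕ) * w k * ∏ b ∈ Finset.range k, t (b+1)) ∧
    (dG n (.inl (.inr ⟨0, by omega⟩)) (mkG _ hg) = c ⟨0, by omega⟩) ∧
    (∀ k : Fin (n-1), dG n (.inr (.inr k)) (mkG _ hg) = c (csc k) * dG n (.inl (.inl (cst k))) (mkG _ hg)) := by
  set g := comp (arrow n t w) c with hgd
  let x : ℕ → ℕ → ℂ := fun b a => if a = 0 then w b else if a = b + 1 then t (b+1) else 0
  have hcol : ∀ b < n-1, ∀ a < n, col (fromB g) b a = x b a := by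
    intro b hb a ha
    rw [col_ll g a b ha (by omega), hgd, comp, fromBlocks_apply₁₁]
    simp only [arrow, x, of_apply]
    rw [if_neg (by omega : ¬ b + 1 = n)]
    split_ifs with h1 h2
    · rfl
    · rw [h2]
    · rfl
  have hcl : ∀ a < n, col (fromB g) (n-1) a = if a = 0 then t 0 else 0 := by
    intro a ha
    rw [col_ll g a (n-1) ha (by omega), hgd, comp, fromBlocks_apply₁₁]
    simp only [arrow, of_apply]
    rw [if_pos (by omega : n - 1 + 1 = n), if_neg (by omega : ¬ a = n - 1 + 1)]
  have hcr : ∀ a (ha : a < n), col (fromB g) n a = c ⟨a, ha⟩ := by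
    intro a ha
    rw [col_lr g a ha, hgd, comp, fromBlocks_apply₁₂, comp_last _ _ (arrow_unit n hn t w ht)]
    simp only
    omega
  have hJ : ∀ (i : ℕ) (hi : i < n) (v : ℕ → ℂ) (hv : ∀ a, 0 < a → a ≤ i → v a = 0),
      mJ (col (fromB g)) i v = (-1)^i * v 0 * ∏ b ∈ Finset.range i, t (b+1) := by
    intro i hi v hv
    rw [mJ_congr (x' := x) (v' := v)
      (fun b hb a ha => hcol b (by omega) a (by omega)) (fun _ _ => rfl), mJ_arrow _ i v t w (fun _ _ _ => rfl) hv]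
  refine ⟨fun i => ?_, fun k => ?_, ?_, fun k => ?_⟩
  · show deltaFn n (Jset n i) (fromB g) = _
    rw [delta_J n i i.2, hJ i i.2 _ (fun a h1 h2 => by rw [hcl a (by omega), if_neg (by omega)]), hcl 0 (by omega),
      if_pos rfl]
  · show deltaFn n (Iset n (k+1)) (fromB g) = _
    have hk := k.2
    rw [delta_I n k k.2, hJ k (by omega) _ (fun a h1 h2 => by
      rw [hcol k k.2 a (by omega)]; simp only [x]; rw [if_neg (by omega), if_neg (by omega)]), hcol k k.2 0 (by omega)]
    simp [x]
  · show deltaFn n (JPset n 0) (fromB g) = _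
    rw [delta_JP n 0 (by omega), hJ 0 (by omega) _ (by omega), hcr 0 (by omega)]
    simp
  · show deltaFn n (Kset n k) (fromB g) = _ * deltaFn n (Jset n k) (fromB g)
    have hk := k.2
    rw [delta_K n k k.2, delta_J n k (by omega), mK_last, hcr (k+1) (by omega)]
    · rfl
    · intro b hb
      rw [hcol b (by omega) _ (by omega)]; simp only [x]; rw [if_neg (by omega), if_neg (by omega)]
    · rw [hcl _ (by omega), if_neg (by omega)]

end

section
/-! ### Reduction to arrow form -/

open Matrix

lemma row_solve (x : ℕ → ℕ → ℂ) (i : ℕ) (p : ℕ → ℂ) (h : mJ x i p ≠ 0) :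
    ∃ l : ℕ → ℂ, l (i+1) = 1 ∧ (∀ j, i+1 < j → l j = 0) ∧
      (∀ b < i, ∑ j ∈ Finset.range (i+2), l j * x b j = 0) ∧ ∑ j ∈ Finset.range (i+2), l j * p j = 0 := by
  set M : Matrix (Fin (i+1)) (Fin (i+1)) ℂ := Matrix.of fun a b => if (b:ℕ) < i then x b a else p a with hM
  have hd : IsUnit M.det := isUnit_iff_ne_zero.2 h
  let r : Fin (i+1) → ℂ := fun b => if (b:ℕ) < i then x b (i+1) else p (i+1)
  let m : Fin (i+1) → ℂ := - (r ᵥ* M⁻¹)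
  have hm : m ᵥ* M = - r := by
    rw [neg_vecMul, vecMul_vecMul, Matrix.nonsing_inv_mul _ hd, vecMul_one]
  let l : ℕ → ℂ := fun j => if h : j < i+1 then m ⟨j, h⟩ else if j = i+1 then 1 else 0
  have hs : ∀ y : ℕ → ℂ, ∑ j ∈ Finset.range (i+2), l j * y j = ∑ a : Fin (i+1), m a * y a + y (i+1) := by
    intro y
    rw [Finset.sum_range_succ, Finset.sum_range]
    congr 1
    · refine Finset.sum_congr rfl fun a _ => ?_
      simp only [l]; rw [dif_pos a.2]
    · simp [l]
  refine ⟨l, by simp [l], fun j hj => ?_, fun b hb => ?_, ?_⟩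
  · simp only [l]; rw [dif_neg (by omega), if_neg (by omega)]
  · rw [hs]
    have := congrFun hm ⟨b, by omega⟩
    simp only [vecMul, dotProduct, hM, of_apply, hb, if_true, Pi.neg_apply, r] at this
    rw [this]; simp
  · rw [hs]
    have := congrFun hm (Fin.last i)
    simp only [vecMul, dotProduct, hM, of_apply, Fin.val_last, lt_irrefl, if_false, Pi.neg_apply, r] at this
    rw [this]; simp

lemma mJ_row_zero (x : ℕ → ℕ → ℂ) (i : ℕ) (v : ℕ → ℂ) (h : ∀ b < i, x b i = 0) (hv : v i = 0) : mJ x i v = 0 := by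
  unfold mJ
  refine det_eq_zero_of_row_eq_zero (Fin.last i) fun b => ?_
  simp only [of_apply, Fin.val_last]
  split_ifs with hb
  · exact h b hb
  · exact hv

lemma exists_L (n : ℕ) (hn : 2 ≤ n) (A : NMat n) (x : ℕ → ℕ → ℂ)
    (hx : ∀ a b (ha : a < n) (hb : b < n), x b a = A ⟨a, ha⟩ ⟨b, hb⟩)
    (hJ : ∀ i < n, mJ x i (x (n-1)) ≠ 0) : ∃ L : NMat n, UU Lᵀ ∧
      (∀ k b : Fin n, (b:ℕ) + 1 < k → (L * A) k b = 0) ∧ (∀ k b : Fin n, 0 < (k:ℕ) → (b:ℕ) + 1 = n → (L * A) k b = 0) := by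
  have h := fun i : Fin n => row_solve x i (x (n-1)) (hJ i i.2)
  choose l h1 h2 h3 h4 using h
  let L : NMat n := Matrix.of fun k j => if hk : (k:ℕ) = 0 then (if (j:ℕ) = 0 then 1 else 0) else l ⟨k-1, by omega⟩ j
  have hL : ∀ (i : ℕ) (hi : i + 1 < n) (b : Fin n), (L * A) ⟨i+1, hi⟩ b =
      ∑ j ∈ Finset.range (i+2), l ⟨i, by omega⟩ j * x b j := by
    intro i hi b
    rw [Matrix.mul_apply]
    have e1 : ∀ j : Fin n, L ⟨i+1, hi⟩ j * A j b = (fun j : ℕ => l ⟨i, by omega⟩ j * x b j) j := by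
      intro j
      simp only [L, of_apply]
      rw [dif_neg (by simp), hx j b j.2 b.2]
      simp
    rw [Finset.sum_congr rfl (fun j _ => e1 j), Fin.sum_univ_eq_sum_range (fun j : ℕ => l ⟨i, by omega⟩ j * x b j)]
    symm
    refine Finset.sum_subset (fun j hj => by simp at hj ⊢; omega) fun j _ hj => ?_
    rw [h2, zero_mul]
    simp at hj ⊢
    omega
  refine ⟨L, ⟨?_, ?_⟩, ?_, ?_⟩
  · intro i j hij
    rw [Fin.lt_def] at hij
    simp only [L, transpose_apply, of_apply]
    split_ifs
    · omega
    · rfl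
    · exact h2 _ _ (by simp; omega)
  · intro i
    simp only [L, transpose_apply, of_apply]
    split_ifs with h
    · rfl
    · have := h1 ⟨i-1, by omega⟩
      simp only at this
      rwa [Nat.sub_add_cancel (by omega)] at this
  · rintro ⟨k, hk⟩ b hb
    obtain ⟨i, rfl⟩ : ∃ i, k = i + 1 := ⟨k-1, by simp at hb; omega⟩
    rw [hL]
    exact h3 _ _ (by simp at hb ⊢; omega)
  · rintro ⟨k, hk⟩ b hk0 hb
    obtain ⟨i, rfl⟩ : ∃ i, k = i + 1 := ⟨k-1, by simp at hk0; omega⟩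
    rw [hL, show (b:ℕ) = n - 1 by omega]
    exact h4 _

lemma exists_a (n : ℕ) (hn : 2 ≤ n) (U : NMat n) (h1 : ∀ k b : Fin n, (b:ℕ) + 1 < k → U k b = 0)
    (h2 : ∀ k b : Fin n, 0 < (k:ℕ) → (b:ℕ) + 1 = n → U k b = 0)
    (h3 : ∀ k b : Fin n, (k:ℕ) = b + 1 → U k b ≠ 0) (h4 : U ⟨0, by omega⟩ ⟨n-1, by omega⟩ ≠ 0) :
    ∃ a : NMat n, UU a ∧ Tr a ∧ ∃ t w : ℕ → ℂ, (∀ i < n, t i ≠ 0) ∧ U * a = arrow n t w := by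
  let V : NMat n := Matrix.of fun k b => if h : (k:ℕ) + 1 < n then U ⟨k+1, h⟩ b else if k = b then 1 else 0
  have hV0 : ∀ i j, j < i → V i j = 0 := by
    intro i j hij
    simp only [V, of_apply]
    split_ifs with h h'
    · exact h1 _ _ (by simpa using hij)
    · exact absurd h' hij.ne'
    · rfl
  have hV1 : ∀ i, V i i ≠ 0 := by
    intro i
    simp only [V, of_apply]
    split_ifs with h
    · exact h3 _ _ rfl
    · exact one_ne_zero
  obtain ⟨hVd, hVi, hVii⟩ := upper_inv V hV0 hV1
  have hVT : Tr V := by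
    intro i j hij
    simp only [V, of_apply]
    split_ifs with h1' h2' h2'
    · subst h2'; omega
    · exact h2 _ _ (by simp) (by omega)
    · rfl
    · rfl
  have hT := hVT.inv hVd
  let a : NMat n := V⁻¹ * diagonal (fun i => V i i)
  have haa : ∀ i j, a i j = V⁻¹ i j * V j j := fun i j => by simp [a, mul_diagonal]
  have haT : Tr a := by
    intro i j hij
    rw [haa, hT i j hij]
    split_ifs with h
    · subst h; rw [hVT i i (by omega)]; simp
    · simp
  refine ⟨a, ⟨fun i j hij => ?_, fun i => ?_⟩, haT, ?_⟩
  · rw [haa, hVi i j hij, zero_mul]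
  · rw [haa, hVii, inv_mul_cancel₀ (hV1 i)]
  · have hVa : V * a = diagonal (fun i => V i i) := by
      simp only [a]; rw [Matrix.mul_nonsing_inv_cancel_left _ _ hVd]
    have hrow : ∀ (k : Fin n) (hk : (k:ℕ) + 1 < n) (b : Fin n), (U * a) ⟨k+1, hk⟩ b = if k = b then V k k else 0 := by
      intro k hk b
      have := congrFun (congrFun hVa k) b
      rw [diagonal_apply, Matrix.mul_apply] at this
      rw [← this, Matrix.mul_apply]
      refine Finset.sum_congr rfl fun c _ => ?_
      congr 1
      simp only [V, of_apply]
      rw [dif_pos hk]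
    have hU0 : (U * a) ⟨0, by omega⟩ ⟨n-1, by omega⟩ = U ⟨0, by omega⟩ ⟨n-1, by omega⟩ := by
      rw [Matrix.mul_apply, Finset.sum_eq_single ⟨n-1, by omega⟩]
      · rw [haT _ _ (Or.inl (by simp; omega)), if_pos rfl, mul_one]
      · intro b _ hb
        rw [haT _ _ (Or.inr (by simp; omega)), if_neg hb, mul_zero]
      · simp
    let t : ℕ → ℂ := fun i => if h : 0 < i ∧ i < n then V ⟨i-1, by omega⟩ ⟨i-1, by omega⟩ else U ⟨0, by omega⟩ ⟨n-1, by omega⟩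
    let w : ℕ → ℂ := fun b => if h : b < n then (U * a) ⟨0, by omega⟩ ⟨b, h⟩ else 0
    refine ⟨t, w, fun i hi => ?_, ?_⟩
    · simp only [t]
      split_ifs
      · exact hV1 _
      · exact h4
    · ext ⟨k, hk⟩ b
      simp only [arrow, of_apply]
      rcases Nat.eq_zero_or_pos k with rfl | hk0
      · rw [if_pos rfl]
        split_ifs with hb
        · have : b = ⟨n-1, by omega⟩ := by ext; simp; omega
          rw [this, hU0]
          simp [t]
        · simp [w]
      · obtain ⟨i, rfl⟩ : ∃ i, k = i + 1 := ⟨k-1, by omega⟩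
        rw [if_neg (by omega)]
        have := hrow ⟨i, by omega⟩ hk b
        simp only at this
        rw [this]
        by_cases h : i = (b:ℕ)
        · rw [if_pos (by ext; exact h), if_pos (by omega)]
          simp [t, hk]
        · rw [if_neg (by rw [Fin.ext_iff]; exact h), if_neg (by omega)]

lemma reduce (n : ℕ) (hn : 2 ≤ n) (x : ↥(SpSet n)) (hJ : ∀ i, dG n (.inl (.inl i)) x ≠ 0) :
    ∃ (t w : ℕ → ℂ) (c : Fin n → ℂ), (∀ i < n, t i ≠ 0) ∧ ∃ hm : comp (arrow n t w) c ∈ SP n,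
      ∀ f ∈ BSet n, f x = f (mkG _ hm) := by
  obtain ⟨A, B, C, D, hABCD⟩ : ∃ A B C D, toB x.1 = fromBlocks A B C D := ⟨_, _, _, _, (fromBlocks_toBlocks _).symm⟩
  have hg : fromBlocks A B C D ∈ SP n := hABCD ▸ toB_mem _ x.2
  have hx : mkG _ hg = x := by
    rw [← mkG_toB x]; simp only [hABCD]
  have hcolA : ∀ a b (ha : a < n) (hb : b < n), col (fromB (fromBlocks A B C D)) b a = A ⟨a, ha⟩ ⟨b, hb⟩ :=
    fun a b ha hb => by rw [col_ll _ a b ha hb, fromBlocks_apply₁₁]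
  obtain ⟨L, hL, hL1, hL2⟩ := exists_L n hn A _ hcolA (fun i hi => by
    have := hJ ⟨i, hi⟩
    rw [← hx] at this
    rw [← delta_J n i hi]
    exact this)
  have hLd : IsUnit L.det := by have := hL.det; rwa [det_transpose] at this
  have hm1 : fromBlocks L 0 0 (L⁻¹)ᵀ * fromBlocks A B C D ∈ SP n := mul_mem (diag_mem L hLd) hg
  have hJ1 : ∀ i, dG n (.inl (.inl i)) (mkG _ hm1) ≠ 0 := by
    intro i
    rw [inv_left (dG_mem n hn (.inl (.inl i))) _ hg L hL hm1, hx]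
    exact hJ i
  have hcolU : ∀ a b (ha : a < n) (hb : b < n), col (fromB (fromBlocks L 0 0 (L⁻¹)ᵀ * fromBlocks A B C D)) b a =
      (L * A) ⟨a, ha⟩ ⟨b, hb⟩ :=
    fun a b ha hb => by rw [col_ll _ a b ha hb, fromBlocks_multiply, fromBlocks_apply₁₁]; simp
  obtain ⟨a, ha, haT, t, w, ht, hUa⟩ := exists_a n hn (L * A) hL1 hL2 (by
      rintro ⟨k, hk⟩ b hkb h0
      simp only at hkb
      subst hkb
      refine hJ1 ⟨b+1, hk⟩ ?_
      show deltaFn n (Jset n (b+1)) _ = 0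
      rw [delta_J n (b+1) hk]
      refine mJ_row_zero _ _ _ (fun c hc => ?_) ?_
      · show col (fromB _) _ _ = 0
        rw [hcolU _ c hk (by omega)]
        by_cases h : c = b
        · subst h; exact h0
        · exact hL1 _ _ (by simp; omega)
      · show col (fromB _) _ _ = 0
        rw [hcolU _ _ hk (by omega)]
        exact hL2 _ _ (by simp) (by simp; omega)) (by
      intro h0
      refine hJ1 ⟨0, by omega⟩ ?_
      show deltaFn n (Jset n 0) _ = 0
      rw [delta_J n 0 (by omega)]
      refine mJ_row_zero _ _ _ (fun c hc => by omega) ?_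
      show col (fromB _) _ _ = 0
      rw [hcolU _ _ (by omega) (by omega)]
      exact h0)
  have hm2 : fromBlocks L 0 0 (L⁻¹)ᵀ * fromBlocks A B C D * fromBlocks a 0 0 (a⁻¹)ᵀ ∈ SP n :=
    mul_mem hm1 (diag_mem a ha.det)
  obtain ⟨B2, C2, D2, h2⟩ : ∃ B2 C2 D2, fromBlocks L 0 0 (L⁻¹)ᵀ * fromBlocks A B C D * fromBlocks a 0 0 (a⁻¹)ᵀ =
      fromBlocks (arrow n t w) B2 C2 D2 := by
    rw [← hUa]
    simp only [fromBlocks_multiply, Matrix.zero_mul, Matrix.mul_zero, add_zero, zero_add]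
    exact ⟨_, _, _, rfl⟩
  have hm2' : fromBlocks (arrow n t w) B2 C2 D2 ∈ SP n := h2 ▸ hm2
  have hN := arrow_unit n hn t w ht
  have hmc : comp (arrow n t w) (fun i => B2 i ⟨n-1, by omega⟩) ∈ SP n := comp_mem _ _ hN
  refine ⟨t, w, fun i => B2 i ⟨n-1, by omega⟩, ht, hmc, fun f hf => ?_⟩
  have e1 := inv_left hf _ hg L hL hm1
  have e2 := inv_right hf _ hm1 a ha haT hm2
  have e3 : f (mkG _ hmc) = f (mkG _ hm2') := inv_same hf _ _ _ _ _ _ _ hm2' hmc hN (fun i j hj => by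
    rw [comp_last _ _ hN i j hj]
    have : j = ⟨n-1, by omega⟩ := by ext; simp; omega
    rw [this])
  have e4 : mkG _ hm2 = mkG _ hm2' := by simp only [h2]
  rw [e3, ← e4, e2, e1, hx]

end

section
/-! ### Localization -/

open Matrix

lemma mv_mem {Ω σ : Type} (S : Subalgebra ℂ (Ω → ℂ)) (F : Ω → σ → ℂ) (hF : ∀ r, (fun s => F s r) ∈ S)
    (P : MvPolynomial σ ℂ) : (fun s => MvPolynomial.eval (F s) P) ∈ S := by
  induction P using MvPolynomial.induction_on with
  | C a => simp only [MvPolynomial.eval_C]; exact S.algebraMap_mem a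
  | add p q hp hq => simp only [map_add]; exact S.add_mem hp hq
  | mul_X p i hp => simp only [map_mul, MvPolynomial.eval_X]; exact S.mul_mem hp (hF i)

def arrowInv (n : ℕ) (t w : ℕ → ℂ) : NMat n := Matrix.of fun a j =>
  if (a:ℕ) + 1 = n then (if (j:ℕ) = 0 then (t 0)⁻¹ else - w (j-1) * (t j)⁻¹ * (t 0)⁻¹)
  else if (j:ℕ) = a + 1 then (t j)⁻¹ else 0

lemma arrow_inv (n : ℕ) (hn : 2 ≤ n) (t w : ℕ → ℂ) (ht : ∀ i < n, t i ≠ 0) : (arrow n t w)⁻¹ = arrowInv n t w := by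
  refine Matrix.inv_eq_left_inv ?_
  ext a b
  rw [Matrix.mul_apply, Matrix.one_apply]
  by_cases ha : (a:ℕ) + 1 = n
  · by_cases hb : (b:ℕ) + 1 = n
    · have hab : a = b := by ext; omega
      rw [if_pos hab, Finset.sum_eq_single ⟨0, by omega⟩]
      · simp [arrow, arrowInv, ha, hb, ht 0 (by omega)]
      · intro j _ hj
        have h0 : (j:ℕ) ≠ 0 := fun h => hj (Fin.ext h)
        have h1 : (j:ℕ) ≠ b + 1 := by omega
        simp [arrow, h0, h1]
      · simp
    · have hab : a ≠ b := by intro h; subst h; omega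
      have hb1 : (b:ℕ) + 1 < n := by omega
      rw [if_neg hab, Finset.sum_eq_add (⟨0, by omega⟩ : Fin n) ⟨b+1, hb1⟩]
      · simp [arrow, arrowInv, ha, hb]
        field_simp [ht 0 (by omega), ht _ hb1]
        ring
      · simp [Fin.ext_iff]
      · rintro j _ ⟨hj, hj'⟩
        have h0 : (j:ℕ) ≠ 0 := fun h => hj (Fin.ext h)
        have h1 : (j:ℕ) ≠ b + 1 := fun h => hj' (Fin.ext h)
        simp [arrow, h0, h1]
      · simp
      · simp
  · have ha1 : (a:ℕ) + 1 < n := by omega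
    rw [Finset.sum_eq_single ⟨a+1, ha1⟩]
    · by_cases hab : a = b
      · subst hab; simp [arrow, arrowInv, ha, ht _ ha1]
      · have : (a:ℕ) ≠ b := fun h => hab (Fin.ext h)
        simp [arrow, hab, this]
    · intro j _ hj
      have h1 : (j:ℕ) ≠ a + 1 := fun h => hj (Fin.ext h)
      simp [arrowInv, ha, h1]
    · simp

/-- the algebra generated by the minors -/
def AA (n : ℕ) : Subalgebra ℂ (↥(SpSet n) → ℂ) := Algebra.adjoin ℂ (Set.range (dG n))

lemma dG_AA (n : ℕ) (c : Lab n) : dG n c ∈ AA n := Algebra.subset_adjoin ⟨c, rfl⟩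

def Om (n : ℕ) : Type := {x : ↥(SpSet n) // ∀ i, dG n (.inl (.inl i)) x ≠ 0}

def Pi0 (n : ℕ) : ↥(SpSet n) → ℂ := ∏ i, dG n (.inl (.inl i))

lemma Pi0_AA (n : ℕ) : Pi0 n ∈ AA n := prod_mem fun i _ => dG_AA n _

/-- the localized algebra on `Om` -/
def GG (n : ℕ) : Subalgebra ℂ (Om n → ℂ) where
  carrier := {φ | ∃ K : ℕ, ∃ r ∈ AA n, ∀ ω : Om n, φ ω * Pi0 n ω.1 ^ K = r ω.1}
  mul_mem' := by
    rintro φ ψ ⟨K, r, hr, h⟩ ⟨K', r', hr', h'⟩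
    refine ⟨K + K', r * r', mul_mem hr hr', fun ω => ?_⟩
    rw [Pi.mul_apply, Pi.mul_apply, ← h, ← h']; ring
  add_mem' := by
    rintro φ ψ ⟨K, r, hr, h⟩ ⟨K', r', hr', h'⟩
    refine ⟨K + K', r * Pi0 n ^ K' + r' * Pi0 n ^ K, add_mem (mul_mem hr (pow_mem (Pi0_AA n) _))
      (mul_mem hr' (pow_mem (Pi0_AA n) _)), fun ω => ?_⟩
    rw [Pi.add_apply, Pi.add_apply, Pi.mul_apply, Pi.mul_apply, Pi.pow_apply, Pi.pow_apply, ← h, ← h']; ring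
  algebraMap_mem' := fun c => ⟨0, algebraMap ℂ _ c, Subalgebra.algebraMap_mem _ c, fun ω => by simp⟩

lemma dG_GG (n : ℕ) (c : Lab n) : (fun ω : Om n => dG n c ω.1) ∈ GG n := ⟨0, dG n c, dG_AA n c, fun ω => by simp⟩

lemma dGinv_GG (n : ℕ) (i : Fin n) : (fun ω : Om n => (dG n (.inl (.inl i)) ω.1)⁻¹) ∈ GG n := by
  refine ⟨1, ∏ j ∈ Finset.univ.erase i, dG n (.inl (.inl j)), prod_mem fun j _ => dG_AA n _, fun ω => ?_⟩
  have : Pi0 n ω.1 = dG n (.inl (.inl i)) ω.1 * (∏ j ∈ Finset.univ.erase i, dG n (.inl (.inl j))) ω.1 := by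
    rw [Pi0, ← Finset.mul_prod_erase _ _ (Finset.mem_univ i), Pi.mul_apply]
  rw [pow_one, this, inv_mul_cancel_left₀ (ω.2 i)]

def Jn (n i : ℕ) (ω : Om n) : ℂ := if h : i < n then dG n (.inl (.inl ⟨i, h⟩)) ω.1 else 1
def In (n k : ℕ) (ω : Om n) : ℂ := if h : k < n-1 then dG n (.inr (.inl ⟨k, h⟩)) ω.1 else 0
def Kn (n k : ℕ) (ω : Om n) : ℂ := if h : k < n-1 then dG n (.inr (.inr ⟨k, h⟩)) ω.1 else 0

lemma GG_const (n : ℕ) (c : ℂ) : (fun _ => c) ∈ GG n := (GG n).algebraMap_mem c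

lemma Jn_GG (n i : ℕ) : (fun ω => Jn n i ω) ∈ GG n := by
  unfold Jn
  split_ifs
  · exact dG_GG n _
  · exact GG_const n 1

lemma Jninv_GG (n i : ℕ) : (fun ω => (Jn n i ω)⁻¹) ∈ GG n := by
  unfold Jn
  split_ifs
  · exact dGinv_GG n _
  · exact GG_const n _

lemma In_GG (n i : ℕ) : (fun ω => In n i ω) ∈ GG n := by
  unfold In
  split_ifs
  · exact dG_GG n _
  · exact GG_const n _

lemma Kn_GG (n i : ℕ) : (fun ω => Kn n i ω) ∈ GG n := by
  unfold Kn
  split_ifs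
  · exact dG_GG n _
  · exact GG_const n _

lemma Jn_ne (n i : ℕ) (ω : Om n) : Jn n i ω ≠ 0 := by
  unfold Jn
  split_ifs
  · exact ω.2 _
  · exact one_ne_zero

def Tn (n : ℕ) (ω : Om n) : ℕ → ℂ
  | 0 => Jn n 0 ω
  | i+1 => (-1) * (Jn n (i+1) ω * (Jn n i ω)⁻¹)

def Wn (n : ℕ) (ω : Om n) (k : ℕ) : ℂ := In n k ω * Jn n 0 ω * (Jn n k ω)⁻¹

def Cn (n : ℕ) (ω : Om n) (i : Fin n) : ℂ :=
  if (i:ℕ) = 0 then dG n (.inl (.inr i)) ω.1 else Kn n (i-1) ω * (Jn n (i-1) ω)⁻¹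

lemma Tn_GG (n i : ℕ) : (fun ω => Tn n ω i) ∈ GG n := by
  cases i with
  | zero => exact Jn_GG n 0
  | succ i => exact mul_mem (GG_const n (-1)) (mul_mem (Jn_GG n (i+1)) (Jninv_GG n i))

lemma Tninv_GG (n i : ℕ) : (fun ω => (Tn n ω i)⁻¹) ∈ GG n := by
  cases i with
  | zero => exact Jninv_GG n 0
  | succ i =>
    have : (fun ω => (Tn n ω (i+1))⁻¹) = (fun _ => (-1:ℂ)) * ((fun ω => (Jn n (i+1) ω)⁻¹) * (fun ω => Jn n i ω)) := by
      ext ω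
      simp only [Tn, Pi.mul_apply, mul_inv, inv_inv]
      norm_num
    rw [this]
    exact mul_mem (GG_const n (-1)) (mul_mem (Jninv_GG n (i+1)) (Jn_GG n i))

lemma Tn_ne (n i : ℕ) (ω : Om n) : Tn n ω i ≠ 0 := by
  cases i with
  | zero => exact Jn_ne n 0 ω
  | succ i => exact mul_ne_zero (by norm_num) (mul_ne_zero (Jn_ne n _ ω) (inv_ne_zero (Jn_ne n _ ω)))

lemma Wn_GG (n k : ℕ) : (fun ω => Wn n ω k) ∈ GG n :=
  mul_mem (mul_mem (In_GG n k) (Jn_GG n 0)) (Jninv_GG n k)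

lemma Cn_GG (n : ℕ) (i : Fin n) : (fun ω => Cn n ω i) ∈ GG n := by
  unfold Cn
  split_ifs
  · exact dG_GG n _
  · exact mul_mem (Kn_GG n _) (Jninv_GG n _)

def GM {n : ℕ} {p q : Type} (M : Om n → Matrix p q ℂ) : Prop := ∀ i j, (fun ω => M ω i j) ∈ GG n

lemma GM.mul {n : ℕ} {p q r : Type} [Fintype q] {M : Om n → Matrix p q ℂ} {N : Om n → Matrix q r ℂ}
    (hM : GM M) (hN : GM N) : GM (fun ω => M ω * N ω) := by
  intro i j
  have : (fun ω => (M ω * N ω) i j) = ∑ k, (fun ω => M ω i k) * (fun ω => N ω k j) := by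
    ext ω; simp [Matrix.mul_apply]
  rw [this]
  exact sum_mem fun k _ => mul_mem (hM i k) (hN k j)

lemma arrow_GM (n : ℕ) : GM (fun ω : Om n => arrow n (Tn n ω) (Wn n ω)) := by
  intro i j
  simp only [arrow, of_apply]
  split_ifs
  · exact Tn_GG n _
  · exact Wn_GG n _
  · exact Tn_GG n _
  · exact GG_const n 0

lemma arrowInv_GM (n : ℕ) : GM (fun ω : Om n => arrowInv n (Tn n ω) (Wn n ω)) := by
  intro i j
  simp only [arrowInv, of_apply]
  split_ifs
  · exact Tninv_GG n _
  · exact mul_mem (mul_mem (neg_mem (Wn_GG n _)) (Tninv_GG n _)) (Tninv_GG n _)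
  · exact Tninv_GG n _
  · exact GG_const n 0

lemma comp_GM (n : ℕ) (hn : 2 ≤ n) : GM (fun ω : Om n => comp (arrow n (Tn n ω) (Wn n ω)) (Cn n ω)) := by
  have hi : ∀ ω : Om n, (arrow n (Tn n ω) (Wn n ω))⁻¹ = arrowInv n (Tn n ω) (Wn n ω) :=
    fun ω => arrow_inv n hn _ _ (fun i _ => Tn_ne n i ω)
  have hs : ∀ i, (fun ω => (arrowInv n (Tn n ω) (Wn n ω) *ᵥ Cn n ω) i) ∈ GG n := by
    intro i
    have : (fun ω => (arrowInv n (Tn n ω) (Wn n ω) *ᵥ Cn n ω) i) =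
        ∑ k, (fun ω => arrowInv n (Tn n ω) (Wn n ω) i k) * (fun ω => Cn n ω k) := by
      ext ω; simp [mulVec, dotProduct]
    rw [this]
    exact sum_mem fun k _ => mul_mem (arrowInv_GM n i k) (Cn_GG n k)
  have hS : GM (fun ω : Om n => Smat (arrowInv n (Tn n ω) (Wn n ω) *ᵥ Cn n ω)) := by
    intro i j
    simp only [Smat, of_apply]
    split_ifs
    · exact hs i
    · exact hs j
    · exact GG_const n 0
  unfold comp
  simp only [hi]
  rintro (i|i) (j|j)
  · exact arrow_GM n i j
  · exact (arrow_GM n).mul hS i j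
  · exact GG_const n 0
  · exact arrowInv_GM n j i

lemma arrow_congr {n : ℕ} {t t' w w' : ℕ → ℂ} (ht : ∀ i < n, t i = t' i) (hw : ∀ k < n-1, w k = w' k) :
    arrow n t w = arrow n t' w' := by
  ext a b
  have := a.2
  simp only [arrow, of_apply]
  split_ifs
  · exact ht 0 (by omega)
  · exact hw b (by omega)
  · exact ht _ a.2
  · rfl

lemma reduce' (n : ℕ) (hn : 2 ≤ n) (ω : Om n) :
    ∃ hm : comp (arrow n (Tn n ω) (Wn n ω)) (Cn n ω) ∈ SP n, ∀ f ∈ BSet n, f ω.1 = f (mkG _ hm) := by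
  obtain ⟨t, w, c, ht, hm, hf⟩ := reduce n hn ω.1 ω.2
  obtain ⟨vJ, vI, vJ', vK⟩ := arrow_vals n hn t w ht c hm
  have hJ : ∀ i (hi : i < n), Jn n i ω = (-1)^i * t 0 * ∏ b ∈ Finset.range i, t (b+1) := by
    intro i hi
    unfold Jn
    rw [dif_pos hi, hf _ (dG_mem n hn _), vJ]
  have eT : ∀ i < n, Tn n ω i = t i := by
    intro i hi
    cases i with
    | zero => rw [Tn, hJ 0 hi]; simp
    | succ i =>
      have hne := Jn_ne n i ω
      have e : Jn n (i+1) ω = Jn n i ω * (- t (i+1)) := by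
        rw [hJ (i+1) hi, hJ i (by omega), Finset.prod_range_succ, pow_succ]; ring
      rw [Tn, e, mul_comm (Jn n i ω), mul_assoc, mul_inv_cancel₀ hne]
      ring
  have eW : ∀ k < n-1, Wn n ω k = w k := by
    intro k hk
    have hne := Jn_ne n k ω
    have h0 := Jn_ne n 0 ω
    have hI : In n k ω = (-1)^k * w k * ∏ b ∈ Finset.range k, t (b+1) := by
      unfold In; rw [dif_pos hk, hf _ (dG_mem n hn _), vI]
    rw [Wn, hI]
    rw [← div_eq_mul_inv, div_eq_iff hne, hJ k (by omega), hJ 0 (by omega)]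
    simp
    ring
  have eC : Cn n ω = c := by
    ext i
    unfold Cn
    split_ifs with h
    · have : i = ⟨0, by omega⟩ := Fin.ext h
      rw [this, hf _ (dG_mem n hn _), vJ']
    · rw [← div_eq_mul_inv, div_eq_iff (Jn_ne n _ ω)]
      have hi : (i:ℕ) - 1 < n - 1 := by omega
      unfold Kn Jn
      rw [dif_pos hi, dif_pos (by omega), hf _ (dG_mem n hn _), vK, hf _ (dG_mem n hn _)]
      congr 2
      ext; simp [csc]; omega
  rw [eC, arrow_congr eT eW]
  exact ⟨hm, hf⟩

lemma local_mem (n : ℕ) (hn : 2 ≤ n) (f : ↥(SpSet n) → ℂ) (hf : f ∈ BSet n) : (fun ω : Om n => f ω.1) ∈ GG n := by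
  obtain ⟨P, hP⟩ := hf.1
  have : (fun ω : Om n => f ω.1) = fun ω => MvPolynomial.eval
      (fun rc : Fin (2*n) × Fin (2*n) => fromB (comp (arrow n (Tn n ω) (Wn n ω)) (Cn n ω)) rc.1 rc.2) P := by
    ext ω
    obtain ⟨hm, h⟩ := reduce' n hn ω
    rw [h f hf, hP]
    rfl
  rw [this]
  exact mv_mem _ _ (fun rc => comp_GM n hn _ _) P

end

section
/-! ### Straightening, cancellation and conclusion -/

open Matrix

def mG (n : ℕ) (e : Lab n → ℕ) (x : ↥(SpSet n)) : ℂ := ∏ c, dG n c x ^ e c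

lemma mG_add (n : ℕ) (e e' : Lab n → ℕ) : mG n (e + e') = mG n e * mG n e' := by
  ext x
  simp only [mG, Pi.mul_apply, Pi.add_apply, pow_add, Finset.prod_mul_distrib]

lemma mG_single (n : ℕ) (c : Lab n) : mG n (Pi.single c 1) = dG n c := by
  ext x
  rw [mG, Finset.prod_eq_single c]
  · simp
  · intro b _ hb; rw [Pi.single_eq_of_ne hb, pow_zero]
  · simp

def RR (n : ℕ) : Submodule ℂ (↥(SpSet n) → ℂ) := Submodule.span ℂ (mG n '' {e | Good n e})

lemma single_le {n : ℕ} {e : Lab n → ℕ} {c : Lab n} (h : e c ≠ 0) : e = (e - Pi.single c 1) + Pi.single c 1 := by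
  ext d
  by_cases hd : d = c
  · subst hd; simp; omega
  · simp [Pi.single_eq_of_ne hd]

lemma dG_rel' (n : ℕ) (k : Fin (n-1)) :
    dG n (.inr (.inl k)) * dG n (.inr (.inr k)) =
      dG n (.inl (.inl (cst k))) * dG n (.inl (.inr (csc k))) -
      dG n (.inl (.inr (cst k))) * dG n (.inl (.inl (csc k))) := by
  ext x; exact dG_rel n k x

lemma straighten (n : ℕ) : ∀ (m : ℕ) (e : Lab n → ℕ), ∑ k, e (.inr (.inl k)) = m → mG n e ∈ RR n := by
  intro m
  induction m using Nat.strong_induction_on with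
  | _ m ih =>
    intro e he
    by_cases hg : Good n e
    · exact Submodule.subset_span ⟨e, hg, rfl⟩
    · simp only [Good, not_forall, not_or] at hg
      obtain ⟨k, h1, h2⟩ := hg
      have e1 := single_le h1
      set e0 := e - Pi.single (Sum.inr (Sum.inl k)) 1 with he0
      have h2' : e0 (.inr (.inr k)) ≠ 0 := by
        simpa [he0] using h2
      have e2 := single_le h2'
      set e00 := e0 - Pi.single (Sum.inr (Sum.inr k)) 1
      have key : mG n e = mG n (e00 + Pi.single (.inl (.inl (cst k))) 1 + Pi.single (.inl (.inr (csc k))) 1) -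
          mG n (e00 + Pi.single (.inl (.inr (cst k))) 1 + Pi.single (.inl (.inl (csc k))) 1) := by
        rw [e1, e2]
        simp only [mG_add, mG_single]
        have := dG_rel' n k
        calc _ = mG n e00 * (dG n (.inr (.inl k)) * dG n (.inr (.inr k))) := by ring
          _ = _ := by rw [this]; ring
      have hlt : ∑ k, e00 (.inr (.inl k)) < m := by
        rw [← he]
        refine Finset.sum_lt_sum (fun i _ => ?_) ⟨k, Finset.mem_univ _, ?_⟩
        · rw [e1, e2]; simp only [Pi.add_apply]; omega
        · rw [e1, e2]; simp
      rw [key]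
      refine sub_mem (ih _ hlt _ ?_) (ih _ hlt _ ?_)
      · refine Finset.sum_congr rfl fun i _ => ?_
        simp
      · refine Finset.sum_congr rfl fun i _ => ?_
        simp

lemma AA_le (n : ℕ) : Subalgebra.toSubmodule (AA n) ≤ RR n := by
  rw [AA, Algebra.adjoin_eq_span, Submodule.span_le]
  intro f hf
  obtain ⟨e, rfl⟩ : ∃ e, mG n e = f := by
    induction hf using Submonoid.closure_induction with
    | mem x hx =>
      obtain ⟨c, rfl⟩ := hx
      exact ⟨_, mG_single n c⟩
    | one => exact ⟨0, by ext x; simp [mG]⟩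
    | mul x y _ _ hx hy =>
      obtain ⟨e, rfl⟩ := hx
      obtain ⟨e', rfl⟩ := hy
      exact ⟨e + e', mG_add n e e'⟩
  exact straighten n _ e rfl

lemma mG_mem (n : ℕ) (hn : 2 ≤ n) (e : Lab n → ℕ) : mG n e ∈ BAlg n := by
  have : mG n e = ∏ c, dG n c ^ e c := by ext x; simp [mG]
  rw [this]
  exact prod_mem fun c _ => pow_mem (dG_mem n hn c) _

lemma exists_h0 (n : ℕ) (hn : 2 ≤ n) : ∃ (h0 : BMat n) (hh : h0 ∈ SP n), ∀ i, dG n (.inl (.inl i)) (mkG h0 hh) ≠ 0 := by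
  obtain ⟨g, hg, h, -, -⟩ := point n hn (fun _ => 1) rfl (by simp) (fun _ => 1) (fun _ => 1) one_ne_zero
  exact ⟨g, hg, fun i => by rw [h]; simp⟩

lemma cancelJ (n : ℕ) (hn : 2 ≤ n) (i : Fin n) (f : ↥(SpSet n) → ℂ) (hf : f ∈ BAlg n)
    (h : dG n (.inl (.inl i)) * f ∈ RR n) : f ∈ RR n := by
  rw [RR, Finsupp.mem_span_image_iff_linearCombination] at h
  obtain ⟨l, hl, hlf⟩ := h
  have hgood : ∀ e ∈ l.support, Good n e := fun e he => hl he
  rw [Finsupp.linearCombination_apply, Finsupp.sum] at hlf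
  have hpt : ∀ x, ∑ e ∈ l.support, l e * mG n e x = dG n (.inl (.inl i)) x * f x := by
    intro x
    have := congrFun hlf x
    simpa using this
  have hz := LI_lemma n hn (l.support.filter (fun e => e (.inl (.inl i)) = 0))
    (fun e he => hgood e (Finset.mem_filter.1 he).1) l (fun j => if j = i then 0 else 1)
    (fun k => by
      by_cases h : cst k = i
      · right
        rw [if_neg]
        · exact one_ne_zero
        · rw [← h]; simp [cst, csc, Fin.ext_iff]
      · left; rw [if_neg h]; exact one_ne_zero)
    (fun e he _ j hj => by
      have : j = i := by by_contra h; simp [h] at hj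
      rw [this]; exact (Finset.mem_filter.1 he).2)
    (fun ι j j' hj' => by
      obtain ⟨g, hg, hv⟩ := point_val n hn (fun j => if j = i then 0 else 1) ι j j' hj'
      have := hpt (mkG g hg)
      rw [hv] at this
      simp only [val, if_true, zero_mul] at this
      rw [Finset.sum_filter]
      refine Eq.trans (Finset.sum_congr rfl fun e _ => ?_) this
      split_ifs with h
      · rw [mG]
        refine congrArg _ (Finset.prod_congr rfl fun c _ => ?_)
        rw [hv]
      · symm
        rw [mG, Finset.prod_eq_zero (Finset.mem_univ (Sum.inl (Sum.inl i))), mul_zero]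
        rw [hv]; simp [val, h])
  have hne : ∀ e ∈ l.support, e (.inl (.inl i)) ≠ 0 := by
    intro e he h0
    exact Finsupp.mem_support_iff.1 he (hz e (Finset.mem_filter.2 ⟨he, h0⟩))
  set q : ↥(SpSet n) → ℂ := ∑ e ∈ l.support, l e • mG n (e - Pi.single (.inl (.inl i)) 1) with hq
  have hqB : q ∈ BAlg n := sum_mem fun e _ => Subalgebra.smul_mem _ (mG_mem n hn _) _
  have hqR : q ∈ RR n := by
    refine sum_mem fun e he => Submodule.smul_mem _ _ (Submodule.subset_span ⟨_, ?_, rfl⟩)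
    intro k
    have := hgood e he k
    simpa using this
  obtain ⟨h0, hh0, hh⟩ := exists_h0 n hn
  have hfq : ∀ x, (f - q) x = 0 := by
    refine density (f - q) (dG n (.inl (.inl i))) (sub_mem hf hqB).1 (dG_poly n _) h0 hh0 (hh i) fun x => ?_
    have : dG n (.inl (.inl i)) x * q x = ∑ e ∈ l.support, l e * mG n e x := by
      rw [hq, Finset.sum_apply, Finset.mul_sum]
      refine Finset.sum_congr rfl fun e he => ?_
      have e1 := congrFun (congrArg (mG n) (single_le (hne e he))) x
      rw [mG_add, mG_single, Pi.mul_apply] at e1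
      rw [e1]
      simp only [Pi.smul_apply, smul_eq_mul]
      ring
    rw [hpt] at this
    rw [Pi.sub_apply, sub_mul, mul_comm, ← this]; ring
  have : f = q := by ext x; have := hfq x; simpa [sub_eq_zero] using this
  rw [this]; exact hqR

lemma cancelProd (n : ℕ) (hn : 2 ≤ n) (s : Finset (Fin n)) : ∀ f ∈ BAlg n,
    (∏ i ∈ s, dG n (.inl (.inl i))) * f ∈ RR n → f ∈ RR n := by
  induction s using Finset.induction_on with
  | empty => intro f _ h; simpa using h
  | insert a s ha ih =>
    intro f hf h
    rw [Finset.prod_insert ha, mul_assoc] at h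
    exact ih f hf (cancelJ n hn a _ (mul_mem (prod_mem fun i _ => dG_mem n hn _) hf) h)

lemma cancelPow (n : ℕ) (hn : 2 ≤ n) (K : ℕ) : ∀ f ∈ BAlg n, Pi0 n ^ K * f ∈ RR n → f ∈ RR n := by
  induction K with
  | zero => intro f _ h; simpa using h
  | succ K ih =>
    intro f hf h
    rw [pow_succ', mul_assoc] at h
    exact ih f hf (cancelProd n hn Finset.univ _
      (mul_mem (pow_mem (prod_mem fun i _ => dG_mem n hn _) _) hf) h)

lemma AA_le_B (n : ℕ) (hn : 2 ≤ n) : AA n ≤ BAlg n := by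
  rw [AA, Algebra.adjoin_le_iff]
  rintro _ ⟨c, rfl⟩
  exact dG_mem n hn c

lemma B_le (n : ℕ) (hn : 2 ≤ n) (f : ↥(SpSet n) → ℂ) (hf : f ∈ BAlg n) : f ∈ RR n := by
  obtain ⟨K, r, hr, h⟩ := local_mem n hn f hf
  have hPi : Pi0 n ∈ BAlg n := prod_mem fun i _ => dG_mem n hn _
  refine cancelPow n hn K f hf ?_
  have : Pi0 n ^ K * f = r := by
    obtain ⟨h0, hh0, hh⟩ := exists_h0 n hn
    have := density (f * Pi0 n ^ K - r) (Pi0 n) (sub_mem (mul_mem hf (pow_mem hPi _)) (AA_le_B n hn hr)).1 hPi.1 h0 hh0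
      (by rw [Pi0, Finset.prod_apply, Finset.prod_ne_zero_iff]; exact fun i _ => hh i) (fun x => by
        by_cases hx : ∀ i, dG n (.inl (.inl i)) x ≠ 0
        · have := h ⟨x, hx⟩
          simp only at this
          rw [Pi.sub_apply, Pi.mul_apply, Pi.pow_apply, this, sub_self, zero_mul]
        · push Not at hx
          obtain ⟨i, hi⟩ := hx
          have : Pi0 n x = 0 := by
            rw [Pi0, Finset.prod_apply]
            exact Finset.prod_eq_zero (Finset.mem_univ i) hi
          rw [this, mul_zero])
    ext x
    have h1 := this x
    rw [Pi.sub_apply, sub_eq_zero] at h1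
    rw [← h1, mul_comm]
  rw [this]
  exact AA_le n hr

lemma RR_eq (n : ℕ) (hn : 2 ≤ n) : RR n = Subalgebra.toSubmodule (BAlg n) := by
  refine le_antisymm ?_ (B_le n hn)
  rw [RR, Submodule.span_le]
  rintro _ ⟨e, _, rfl⟩
  exact mG_mem n hn e

lemma mG_LI (n : ℕ) (hn : 2 ≤ n) : LinearIndependent ℂ (fun e : {e : Lab n → ℕ // Good n e} => mG n e.1) := by
  classical
  rw [linearIndependent_iff']
  intro s g hg e he
  have := LI_lemma n hn (s.map ⟨Subtype.val, Subtype.val_injective⟩)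
    (fun e he => by
      obtain ⟨a, _, rfl⟩ := Finset.mem_map.1 he
      exact a.2)
    (fun e => if h : Good n e then g ⟨e, h⟩ else 0) (fun _ => 1) (fun k => Or.inl one_ne_zero)
    (fun e _ _ i hi => absurd hi one_ne_zero)
    (fun ι j j' hj' => by
      obtain ⟨x, hx, hv⟩ := point_val n hn (fun _ => 1) ι j j' hj'
      rw [Finset.sum_map]
      have := congrFun hg (mkG x hx)
      simp only [Finset.sum_apply, Pi.smul_apply, smul_eq_mul, Pi.zero_apply] at this
      rw [← this]
      refine Finset.sum_congr rfl fun a _ => ?_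
      simp only [Function.Embedding.coeFn_mk]
      rw [dif_pos a.2]
      simp only [mG, hv])
    e.1 (Finset.mem_map.2 ⟨e, he, rfl⟩)
  rwa [dif_pos e.2] at this

lemma std_mG (n : ℕ) (hn : 2 ≤ n) (l : List (Finset (Fin (2*n)))) (h : IsMultichain n l) :
    (fun x : ↥(SpSet n) => stdMonomial n l (x : Matrix (Fin (2*n)) (Fin (2*n)) ℂ)) = mG n (ecount n l) := by
  ext x
  rw [std_eq_mono n hn l h.1]
  rfl

end

/-- `B` is a ℂ-subalgebra of the algebra of functions on `G_n`, and the
restrictions to `G_n` of the standard monomials `δ_Δ`, as `Δ` ranges over all multichains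
in `𝓛`, form a ℂ-vector space basis of `B`. -/
theorem statement0 (n : ℕ) (hn : 2 ≤ n) :
    ∃ S : Subalgebra ℂ (↥(SpSet n) → ℂ),
      (S : Set (↥(SpSet n) → ℂ)) = BSet n ∧
      LinearIndependent ℂ
        (fun Δ : {l : List (Finset (Fin (2*n))) // IsMultichain n l} =>
          (fun x : ↥(SpSet n) => stdMonomial n Δ.1 (x : Matrix (Fin (2*n)) (Fin (2*n)) ℂ))) ∧
      Submodule.span ℂ
        (Set.range (fun Δ : {l : List (Finset (Fin (2*n))) // IsMultichain n l} =>
          (fun x : ↥(SpSet n) => stdMonomial n Δ.1 (x : Matrix (Fin (2*n)) (Fin (2*n)) ℂ)))) =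
        Subalgebra.toSubmodule S := by
  refine ⟨BAlg n, rfl, ?_, ?_⟩
  · have hinj : Function.Injective (fun Δ : {l : List (Finset (Fin (2*n))) // IsMultichain n l} =>
        (⟨ecount n Δ.1, multichain_good n hn Δ.1 Δ.2⟩ : {e : Lab n → ℕ // Good n e})) := by
      intro Δ Δ' h
      exact Subtype.ext (multichain_inj n hn _ _ Δ.2 Δ'.2 (congrArg Subtype.val h))
    have := (mG_LI n hn).comp _ hinj
    convert this using 1
    ext1 Δ
    exact std_mG n hn Δ.1 Δ.2
  · rw [← RR_eq n hn, RR]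
    congr 1
    ext f
    constructor
    · rintro ⟨Δ, rfl⟩
      exact ⟨ecount n Δ.1, multichain_good n hn Δ.1 Δ.2, (std_mG n hn Δ.1 Δ.2).symm⟩
    · rintro ⟨e, he, rfl⟩
      obtain ⟨l, hl, rfl⟩ := multichain_exists n hn e he
      exact ⟨⟨l, hl⟩, std_mG n hn l hl⟩

end SpBranch
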